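/- Let 0 < α < 1 and let j₀ ≥ 4 be an integer. For smooth f, g: 𝕋² → ℝ, define the high–low part T_{HL}[f,g] = Σ_{j ∈ ℤ} T[Δ_j f, S_{j−j₀} g] of the bilinear operator T[f,g] = Λ^{−1}((Λf)g − f(Λg)). Then for every l ∈ ℤ, ‖Δ_l T_{HL}[f,g]‖₀ ≲ 2^{−lα} ‖f‖_α ‖g‖₀, and consequently ‖T_{HL}[f,g]‖_α ≲ ‖f‖_α ‖g‖₀, with implicit constants depending only on α and j₀. The same bounds hold for the low–high part T_{LH}[f,g] = Σ_{j ∈ ℤ} T[S_{j−j₀} f, Δ_j g] with the roles of f and g exchanged. -/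

import Mathlib

/-!
Common setup: functions on the torus `𝕋^d = ℝ^d/(2πℤ)^d` are modelled as
`2π`-periodic functions on `ℝ^d = Fin d → ℝ`, with Fourier coefficients,
Fourier multiplier operators, Hölder norms, etc.
-/

noncomputable section

open scoped BigOperators
open MeasureTheory

/-- Points of `ℝ^d` (covering the torus `𝕋^d = ℝ^d/(2πℤ)^d`). -/
abbrev Vd (d : ℕ) := Fin d → ℝ

/-- The lattice vector `2π m`. -/
def latt {d : ℕ} (m : Fin d → ℤ) : Vd d := fun i => 2 * Real.pi * (m i : ℝ)

/-- `f` is `2π`-periodic in each coordinate, i.e. a function on the torus `𝕋^d`. -/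
def TorusFun {d : ℕ} {F : Type*} (f : Vd d → F) : Prop :=
  ∀ (x : Vd d) (m : Fin d → ℤ), f (x + latt m) = f x

/-- Dot product of an integer frequency with a point of `ℝ^d`. -/
def dotZ {d : ℕ} (k : Fin d → ℤ) (x : Vd d) : ℝ := ∑ i, (k i : ℝ) * x i

/-- The Euclidean norm on `ℝ^d`. -/
def eNorm {d : ℕ} (x : Vd d) : ℝ := Real.sqrt (∑ i, (x i) ^ 2)

/-- `|k|` for an integer frequency `k ∈ ℤ^d`. -/
def kAbs {d : ℕ} (k : Fin d → ℤ) : ℝ := eNorm (fun i => (k i : ℝ))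

/-- The fundamental domain `[0,2π]^d`. -/
def box (d : ℕ) : Set (Vd d) := Set.Icc 0 (fun _ => 2 * Real.pi)

/-- Mean-zero (real-valued) function on the torus. -/
def MeanZeroR {d : ℕ} (f : Vd d → ℝ) : Prop := ∫ x in box d, f x = 0

/-- Fourier coefficient `f̂(k)` of a function on the torus. -/
def fCoeff {d : ℕ} (f : Vd d → ℂ) (k : Fin d → ℤ) : ℂ :=
  (((2 * Real.pi) ^ d)⁻¹ : ℝ) • ∫ x in box d, f x * Complex.exp (-(Complex.I * (dotZ k x : ℂ)))

/-- Fourier multiplier operator with symbol `m : ℤ^d → ℂ`. -/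
def fmul {d : ℕ} (m : (Fin d → ℤ) → ℂ) (f : Vd d → ℂ) : Vd d → ℂ :=
  fun x => ∑' k : Fin d → ℤ, m k * fCoeff f k * Complex.exp (Complex.I * (dotZ k x : ℂ))

/-- `Λ^s = (-Δ)^{s/2}`: Fourier multiplier with symbol `|k|^s` (acting on mean-zero parts). -/
def LamPow {d : ℕ} (s : ℝ) : (Vd d → ℂ) → Vd d → ℂ :=
  fmul (fun k => if k = 0 then 0 else (((kAbs k) ^ s : ℝ) : ℂ))

/-- `Λ = (-Δ)^{1/2}`. -/
def Lam1 {d : ℕ} : (Vd d → ℂ) → Vd d → ℂ := LamPow 1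

/-- `i`-th component of the SQG operator `∇^⊥Λ^{-1} = (-∂₂Λ^{-1}, ∂₁Λ^{-1})`,
with symbols `(-i k₂/|k|, i k₁/|k|)`. -/
def sqgOp (i : Fin 2) : (Vd 2 → ℂ) → Vd 2 → ℂ :=
  fmul (fun k => if k = 0 then 0 else
    (if i = 0 then -(Complex.I * (k 1 : ℂ)) else Complex.I * (k 0 : ℂ)) / ((kAbs k : ℝ) : ℂ))

/-- First-order partial derivative `∂_i`. -/
def pd {d : ℕ} {F : Type*} [NormedAddCommGroup F] [NormedSpace ℝ F]
    (i : Fin d) (f : Vd d → F) (x : Vd d) : F :=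
  fderiv ℝ f x (Pi.single i 1)

/-- Complexification of a real-valued function. -/
def cplx {d : ℕ} (f : Vd d → ℝ) : Vd d → ℂ := fun x => (f x : ℂ)

/-- The `C^N` norm: sum of sup-norms of the iterated derivatives of order `≤ N`. -/
def CkNorm {d : ℕ} {F : Type*} [NormedAddCommGroup F] [NormedSpace ℝ F]
    (N : ℕ) (f : Vd d → F) : ℝ :=
  ∑ n ∈ Finset.range (N + 1), ⨆ x : Vd d, ‖iteratedFDeriv ℝ n f x‖

/-- The `α`-Hölder seminorm. -/
def hSemi {d : ℕ} {F : Type*} [NormedAddCommGroup F] (α : ℝ) (f : Vd d → F) : ℝ :=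
  ⨆ p : Vd d × Vd d, if p.1 = p.2 then 0 else ‖f p.1 - f p.2‖ / ‖p.1 - p.2‖ ^ α

/-- The `C^{N,α}` Hölder norm `‖f‖_{N+α}`. -/
def HolNorm {d : ℕ} {F : Type*} [NormedAddCommGroup F] [NormedSpace ℝ F]
    (N : ℕ) (α : ℝ) (f : Vd d → F) : ℝ :=
  CkNorm N f + hSemi α (iteratedFDeriv ℝ N f)

/-- `∇^⊥·div R` for a `2`-tensor field `R` on `ℝ²` (values in any normed space). -/
def perpDivDiv {F : Type*} [NormedAddCommGroup F] [NormedSpace ℝ F]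
    (R : Vd 2 → Fin 2 → Fin 2 → F) (x : Vd 2) : F :=
  - pd 1 (fun y => ∑ j, pd j (fun z => R z 0 j) y) x
  + pd 0 (fun y => ∑ j, pd j (fun z => R z 1 j) y) x

/-- Material derivative `D_t f = ∂_t f + u·∇f`. -/
def matD (u : ℝ → Vd 2 → Fin 2 → ℝ) (f : ℝ → Vd 2 → ℝ) (t : ℝ) (x : Vd 2) : ℝ :=
  deriv (fun s => f s x) t + ∑ i, u t x i * pd i (f t) x

/-- The SQG–Reynolds system `∂_tθ + u·∇θ = ∇^⊥·div R`, `u = ∇^⊥Λ^{-1}θ`,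
for smooth space-periodic data with `R` symmetric. -/
structure SQGReynolds (θ : ℝ → Vd 2 → ℝ) (u : ℝ → Vd 2 → Fin 2 → ℝ)
    (R : ℝ → Vd 2 → Fin 2 → Fin 2 → ℝ) : Prop where
  smooth_θ : ContDiff ℝ (⊤ : ℕ∞) fun p : ℝ × Vd 2 => θ p.1 p.2
  smooth_u : ContDiff ℝ (⊤ : ℕ∞) fun p : ℝ × Vd 2 => u p.1 p.2
  smooth_R : ContDiff ℝ (⊤ : ℕ∞) fun p : ℝ × Vd 2 => R p.1 p.2
  periodic_θ : ∀ t, TorusFun (θ t)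
  periodic_u : ∀ t, TorusFun (u t)
  periodic_R : ∀ t, TorusFun (R t)
  symm_R : ∀ t x i j, R t x i j = R t x j i
  vel : ∀ t x i, (u t x i : ℂ) = sqgOp i (cplx (θ t)) x
  eqn : ∀ t x, matD u θ t x = perpDivDiv (R t) x

/-- The bilinear operator `T[f,g] = Λ^{-1}((Λf)g - f(Λg))`. -/
def Tbil (f g : Vd 2 → ℂ) : Vd 2 → ℂ :=
  LamPow (-1) (fun x => Lam1 f x * g x - f x * Lam1 g x)

/-- A Littlewood–Paley bump: smooth, spherically symmetric, `ψ = 1` on `B₁(0)`,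
`supp ψ ⊂ B_{3/2}(0)`. -/
structure LPfun {d : ℕ} (ψ : Vd d → ℝ) : Prop where
  smooth : ContDiff ℝ (⊤ : ℕ∞) ψ
  radial : ∀ x y : Vd d, eNorm x = eNorm y → ψ x = ψ y
  supp : ∀ x, 3/2 ≤ eNorm x → ψ x = 0
  one : ∀ x, eNorm x ≤ 1 → ψ x = 1

/-- Littlewood–Paley block `Δ_j f` (with `Δ_{-1}f = f̂(0)`, `Δ_j f = 0` for `j < -1`). -/
def LPblock {d : ℕ} (ψ : Vd d → ℝ) (j : ℤ) (f : Vd d → ℂ) : Vd d → ℂ :=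
  if j < -1 then 0
  else if j = -1 then fun _ => fCoeff f 0
  else fun x => ∑' k : Fin d → ℤ,
    (((ψ (fun i => (k i : ℝ) / 2 ^ j) - ψ (fun i => (k i : ℝ) / 2 ^ (j - 1))) : ℝ) : ℂ)
      * fCoeff f k * Complex.exp (Complex.I * (dotZ k x : ℂ))

/-- Low-frequency projection `S_j f = Σ_{i ≤ j} Δ_i f`. -/
def LPlow {d : ℕ} (ψ : Vd d → ℝ) (j : ℤ) (f : Vd d → ℂ) : Vd d → ℂ :=
  if j < -1 then 0
  else if j = -1 then fun _ => fCoeff f 0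
  else fun x => ∑' k : Fin d → ℤ,
    ((ψ (fun i => (k i : ℝ) / 2 ^ j) : ℝ) : ℂ)
      * fCoeff f k * Complex.exp (Complex.I * (dotZ k x : ℂ))

/-- The high–low paraproduct part `T_{HL}[f,g] = Σ_j T[Δ_j f, S_{j-j₀} g]`. -/
def THL (ψ : Vd 2 → ℝ) (j₀ : ℤ) (f g : Vd 2 → ℂ) : Vd 2 → ℂ :=
  fun x => ∑' j : ℤ, Tbil (LPblock ψ j f) (LPlow ψ (j - j₀) g) x

/-- The low–high paraproduct part `T_{LH}[f,g] = Σ_j T[S_{j-j₀} f, Δ_j g]`. -/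
def TLH (ψ : Vd 2 → ℝ) (j₀ : ℤ) (f g : Vd 2 → ℂ) : Vd 2 → ℂ :=
  fun x => ∑' j : ℤ, Tbil (LPlow ψ (j - j₀) f) (LPblock ψ j g) x

/-- The character `x ↦ e^{ik·x}` of the torus. -/
def tchar {d : ℕ} (k : Fin d → ℤ) : Vd d → ℂ :=
  fun x => Complex.exp (Complex.I * (dotZ k x : ℂ))

section Characters

variable {d : ℕ}

lemma dotZ_add_right (k : Fin d → ℤ) (x y : Vd d) : dotZ k (x + y) = dotZ k x + dotZ k y := by
  simp [dotZ, mul_add, Finset.sum_add_distrib]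

lemma dotZ_smul_right (k : Fin d → ℤ) (c : ℝ) (x : Vd d) : dotZ k (c • x) = c * dotZ k x := by
  simp only [dotZ, Finset.mul_sum, Pi.smul_apply, smul_eq_mul]
  exact Finset.sum_congr rfl fun i _ => by ring

lemma dotZ_add_left (k m : Fin d → ℤ) (x : Vd d) : dotZ (k + m) x = dotZ k x + dotZ m x := by
  simp [dotZ, add_mul, Finset.sum_add_distrib]

lemma continuous_dotZ (k : Fin d → ℤ) : Continuous (dotZ k) := by
  unfold dotZ
  fun_prop

lemma continuous_tchar (k : Fin d → ℤ) : Continuous (tchar k) := by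
  have := continuous_dotZ k
  unfold tchar
  fun_prop

lemma norm_tchar (k : Fin d → ℤ) (x : Vd d) : ‖tchar k x‖ = 1 := by
  rw [tchar, mul_comm]
  exact Complex.norm_exp_ofReal_mul_I _

lemma tchar_add_left (k m : Fin d → ℤ) : tchar (k + m) = tchar k * tchar m := by
  funext x
  simp [tchar, dotZ_add_left, mul_add, Complex.exp_add]

lemma tchar_add_right (k : Fin d → ℤ) (x y : Vd d) :
    tchar k (x + y) = tchar k x * tchar k y := by
  simp [tchar, dotZ_add_right, mul_add, Complex.exp_add]

lemma tchar_zero : tchar (0 : Fin d → ℤ) = 1 := by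
  funext x
  simp [tchar, dotZ]

lemma tchar_eq_prod (k : Fin d → ℤ) (x : Vd d) :
    tchar k x = ∏ i, Complex.exp (Complex.I * ((k i : ℂ) * (x i : ℂ))) := by
  rw [← Complex.exp_sum, ← Finset.mul_sum]
  simp [tchar, dotZ]

lemma setIntegral_exp_int (n : ℤ) :
    ∫ x in Set.Icc (0 : ℝ) (2 * Real.pi), Complex.exp (Complex.I * ((n : ℂ) * (x : ℂ)))
      = if n = 0 then (2 * Real.pi : ℂ) else 0 := by
  rw [integral_Icc_eq_integral_Ioc, ← intervalIntegral.integral_of_le (by positivity)]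
  split_ifs with hn
  · simp [hn]
  · have hc : Complex.I * (n : ℂ) ≠ 0 := mul_ne_zero Complex.I_ne_zero (by exact_mod_cast hn)
    simp_rw [← mul_assoc]
    rw [integral_exp_mul_complex hc]
    have : Complex.I * (n : ℂ) * ((2 * Real.pi : ℝ) : ℂ) = n * (2 * Real.pi * Complex.I) := by
      push_cast; ring
    rw [this, Complex.exp_int_mul_two_pi_mul_I]
    simp

lemma box_eq_pi : box d = Set.univ.pi fun _ => Set.Icc (0 : ℝ) (2 * Real.pi) := by
  rw [Set.pi_univ_Icc]
  rfl

lemma setIntegral_tchar (k : Fin d → ℤ) :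
    ∫ x in box d, tchar k x = if k = 0 then (2 * Real.pi : ℂ) ^ d else 0 := by
  simp_rw [tchar_eq_prod]
  rw [box_eq_pi, volume_pi, Measure.restrict_pi_pi,
    integral_fintype_prod_eq_prod (𝕜 := ℂ)
      (fun i (t : ℝ) => Complex.exp (Complex.I * ((k i : ℂ) * (t : ℂ))))]
  simp_rw [setIntegral_exp_int]
  split_ifs with hk
  · simp [hk]
  · obtain ⟨i, hi⟩ := Function.ne_iff.mp hk
    exact Finset.prod_eq_zero (Finset.mem_univ i) (if_neg hi)

lemma tchar_neg (k : Fin d → ℤ) (x : Vd d) :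
    tchar (-k) x = Complex.exp (-(Complex.I * (dotZ k x : ℂ))) := by
  simp [tchar, dotZ, Finset.sum_neg_distrib]

lemma fCoeff_eq (f : Vd d → ℂ) (k : Fin d → ℤ) :
    fCoeff f k = (((2 * Real.pi) ^ d)⁻¹ : ℝ) • ∫ x in box d, f x * tchar (-k) x := by
  simp_rw [tchar_neg]
  rfl

lemma fCoeff_tchar (m k : Fin d → ℤ) : fCoeff (tchar m) k = if m = k then 1 else 0 := by
  rw [fCoeff_eq]
  have : ∀ x, tchar m x * tchar (-k) x = tchar (m + -k) x := fun x => by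
    rw [tchar_add_left]; rfl
  simp_rw [this, setIntegral_tchar, ← sub_eq_add_neg, sub_eq_zero]
  split_ifs
  · have : (2 * (Real.pi : ℂ)) ^ d ≠ 0 := pow_ne_zero _ (by simp [Real.pi_ne_zero])
    rw [Complex.real_smul]
    push_cast
    exact inv_mul_cancel₀ this
  · simp

lemma integrableOn_mul_tchar {f : Vd d → ℂ} (hf : Continuous f) (k : Fin d → ℤ) :
    IntegrableOn (fun x => f x * tchar k x) (box d) :=
  (hf.mul (continuous_tchar k)).integrableOn_Icc

lemma fCoeff_add {f g : Vd d → ℂ} (hf : Continuous f) (hg : Continuous g) (k : Fin d → ℤ) :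
    fCoeff (f + g) k = fCoeff f k + fCoeff g k := by
  simp only [fCoeff_eq, Pi.add_apply, add_mul]
  rw [integral_add (integrableOn_mul_tchar hf _) (integrableOn_mul_tchar hg _), smul_add]

lemma fCoeff_smul (c : ℂ) (f : Vd d → ℂ) (k : Fin d → ℤ) :
    fCoeff (c • f) k = c * fCoeff f k := by
  simp only [fCoeff_eq, Pi.smul_apply, smul_eq_mul, mul_assoc]
  rw [integral_const_mul, mul_smul_comm]

lemma fCoeff_sub {f g : Vd d → ℂ} (hf : Continuous f) (hg : Continuous g) (k : Fin d → ℤ) :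
    fCoeff (f - g) k = fCoeff f k - fCoeff g k := by
  simp only [fCoeff_eq, Pi.sub_apply, sub_mul]
  rw [integral_sub (integrableOn_mul_tchar hf _) (integrableOn_mul_tchar hg _), smul_sub]

lemma fCoeff_sum {ι : Type*} (t : Finset ι) {f : ι → Vd d → ℂ} (hf : ∀ i, Continuous (f i))
    (k : Fin d → ℤ) : fCoeff (∑ i ∈ t, f i) k = ∑ i ∈ t, fCoeff (f i) k := by
  simp only [fCoeff_eq, Finset.sum_apply, Finset.sum_mul]
  rw [integral_finsetSum _ fun i _ => integrableOn_mul_tchar (hf i) _, Finset.smul_sum]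

lemma volume_real_box : volume.real (box d) = (2 * Real.pi) ^ d := by
  rw [box, measureReal_def, Real.volume_Icc_pi_toReal]
  · simp
  · intro i; simp [Real.pi_pos.le]

lemma norm_fCoeff_le {f : Vd d → ℂ} {M : ℝ} (hf : ∀ x, ‖f x‖ ≤ M) (k : Fin d → ℤ) :
    ‖fCoeff f k‖ ≤ M := by
  have h : ‖∫ x in box d, f x * tchar (-k) x‖ ≤ M * volume.real (box d) := by
    refine norm_setIntegral_le_of_norm_le_const isCompact_Icc.measure_lt_top fun x _ => ?_
    rw [norm_mul, norm_tchar, mul_one]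
    exact hf x
  have hpos : (0 : ℝ) < (2 * Real.pi) ^ d := by positivity
  rw [fCoeff_eq, norm_smul, Real.norm_of_nonneg (by positivity), inv_mul_le_iff₀ hpos, mul_comm]
  rwa [volume_real_box] at h

end Characters

/-- Trigonometric polynomials with frequencies in `s`. -/
def trigSpan {d : ℕ} (s : Set (Fin d → ℤ)) : Submodule ℂ (Vd d → ℂ) :=
  Submodule.span ℂ (tchar '' s)

section TrigPolynomials

variable {d : ℕ} {s t : Set (Fin d → ℤ)}

lemma tchar_mem_trigSpan {k : Fin d → ℤ} (hk : k ∈ s) : tchar k ∈ trigSpan s :=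
  Submodule.subset_span ⟨k, hk, rfl⟩

lemma trigSpan_mono (h : s ⊆ t) : trigSpan s ≤ trigSpan t :=
  Submodule.span_mono (Set.image_mono h)

lemma exists_of_mem_trigSpan {h : Vd d → ℂ} (hh : h ∈ trigSpan s) :
    ∃ (u : Finset (Fin d → ℤ)) (c : (Fin d → ℤ) → ℂ), (u : Set (Fin d → ℤ)) ⊆ s ∧
      h = ∑ k ∈ u, c k • tchar k := by
  obtain ⟨l, hl, rfl⟩ := (Finsupp.mem_span_image_iff_linearCombination ℂ).mp hh
  exact ⟨l.support, l, hl, rfl⟩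

lemma sum_mem_trigSpan {u : Finset (Fin d → ℤ)} {c : (Fin d → ℤ) → ℂ}
    (h : ∀ k ∈ u, c k ≠ 0 → k ∈ s) : ∑ k ∈ u, c k • tchar k ∈ trigSpan s := by
  refine Submodule.sum_mem _ fun k hk => ?_
  by_cases hc : c k = 0
  · simp [hc]
  · exact Submodule.smul_mem _ _ (tchar_mem_trigSpan (h k hk hc))

lemma continuous_of_mem_trigSpan {h : Vd d → ℂ} (hh : h ∈ trigSpan s) : Continuous h := by
  obtain ⟨u, c, -, rfl⟩ := exists_of_mem_trigSpan hh
  have : (∑ k ∈ u, c k • tchar k) = fun x => ∑ k ∈ u, c k • tchar k x := by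
    funext x; simp
  rw [this]
  exact continuous_finsetSum _ fun k _ => (continuous_tchar k).const_smul (c k)

lemma mul_mem_trigSpan {f g : Vd d → ℂ} {r : Set (Fin d → ℤ)} (hf : f ∈ trigSpan s)
    (hg : g ∈ trigSpan t) (hr : ∀ k ∈ s, ∀ m ∈ t, k + m ∈ r) : f * g ∈ trigSpan r := by
  have h := Submodule.mul_mem_mul hf hg
  rw [trigSpan, trigSpan, Submodule.span_mul_span] at h
  refine Submodule.span_mono ?_ h
  rintro _ ⟨_, ⟨k, hk, rfl⟩, _, ⟨m, hm, rfl⟩, rfl⟩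
  exact ⟨k + m, hr k hk m hm, tchar_add_left k m⟩

lemma fCoeff_sum_tchar (u : Finset (Fin d → ℤ)) (c : (Fin d → ℤ) → ℂ) (k : Fin d → ℤ) :
    fCoeff (∑ m ∈ u, c m • tchar m) k = if k ∈ u then c k else 0 := by
  rw [fCoeff_sum _ fun m => (continuous_tchar m).const_smul (c m)]
  simp [fCoeff_smul, fCoeff_tchar]

lemma fCoeff_eq_zero_of_mem_trigSpan {h : Vd d → ℂ} (hh : h ∈ trigSpan s) {k : Fin d → ℤ}
    (hk : k ∉ s) : fCoeff h k = 0 := by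
  obtain ⟨u, c, hu, rfl⟩ := exists_of_mem_trigSpan hh
  rw [fCoeff_sum_tchar]
  exact if_neg fun h => hk (hu h)

lemma fmul_eq_sum {m : (Fin d → ℤ) → ℂ} {f : Vd d → ℂ} {u : Finset (Fin d → ℤ)}
    (h : ∀ k ∉ u, m k * fCoeff f k = 0) :
    fmul m f = ∑ k ∈ u, (m k * fCoeff f k) • tchar k := by
  funext x
  rw [fmul, tsum_eq_sum (s := u) fun k hk => by rw [h k hk, zero_mul]]
  simp [tchar]

lemma fmul_sum_tchar (m : (Fin d → ℤ) → ℂ) (u : Finset (Fin d → ℤ)) (c : (Fin d → ℤ) → ℂ) :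
    fmul m (∑ k ∈ u, c k • tchar k) = ∑ k ∈ u, (m k * c k) • tchar k := by
  rw [fmul_eq_sum (u := u) fun k hk => by rw [fCoeff_sum_tchar, if_neg hk, mul_zero]]
  exact Finset.sum_congr rfl fun k hk => by rw [fCoeff_sum_tchar, if_pos hk]

lemma fmul_mem_trigSpan {h : Vd d → ℂ} (hh : h ∈ trigSpan s) (m : (Fin d → ℤ) → ℂ) :
    fmul m h ∈ trigSpan s := by
  obtain ⟨u, c, hu, rfl⟩ := exists_of_mem_trigSpan hh
  rw [fmul_sum_tchar]
  exact sum_mem_trigSpan fun k hk _ => hu hk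

lemma fmul_congr_of_mem_trigSpan {h : Vd d → ℂ} (hh : h ∈ trigSpan s) {m m' : (Fin d → ℤ) → ℂ}
    (hm : ∀ k ∈ s, m k = m' k) : fmul m h = fmul m' h := by
  obtain ⟨u, c, hu, rfl⟩ := exists_of_mem_trigSpan hh
  rw [fmul_sum_tchar, fmul_sum_tchar]
  exact Finset.sum_congr rfl fun k hk => by rw [hm k (hu hk)]

lemma fmul_add_of_mem_trigSpan {f g : Vd d → ℂ} (hf : f ∈ trigSpan s) (hg : g ∈ trigSpan t)
    (m : (Fin d → ℤ) → ℂ) : fmul m (f + g) = fmul m f + fmul m g := by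
  classical
  obtain ⟨u, a, -, hu⟩ := exists_of_mem_trigSpan hf
  obtain ⟨v, b, -, hv⟩ := exists_of_mem_trigSpan hg
  have key : ∀ k, k ∉ u ∪ v → fCoeff f k = 0 ∧ fCoeff g k = 0 := by
    intro k hk
    rw [Finset.mem_union, not_or] at hk
    rw [hu, hv, fCoeff_sum_tchar, fCoeff_sum_tchar, if_neg hk.1, if_neg hk.2]
    exact ⟨rfl, rfl⟩
  have hadd := fCoeff_add (continuous_of_mem_trigSpan hf) (continuous_of_mem_trigSpan hg)
  rw [fmul_eq_sum (u := u ∪ v) (f := f) fun k hk => by rw [(key k hk).1, mul_zero],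
    fmul_eq_sum (u := u ∪ v) (f := g) fun k hk => by rw [(key k hk).2, mul_zero],
    fmul_eq_sum (u := u ∪ v) (f := f + g) fun k hk => by
      rw [hadd, (key k hk).1, (key k hk).2, add_zero, mul_zero], ← Finset.sum_add_distrib]
  exact Finset.sum_congr rfl fun k _ => by rw [hadd, mul_add, add_smul]

lemma fmul_smul (c : ℂ) (m : (Fin d → ℤ) → ℂ) (f : Vd d → ℂ) :
    fmul m (c • f) = c • fmul m f := by
  funext x
  simp only [fmul, fCoeff_smul, Pi.smul_apply, smul_eq_mul, ← tsum_mul_left]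
  exact tsum_congr fun k => by ring

end TrigPolynomials

section Approximation

variable {d : ℕ}

lemma exists_trigSpan_approx {f : Vd d → ℂ} (hf : Continuous f) (hp : TorusFun f) {ε : ℝ}
    (hε : 0 < ε) : ∃ h ∈ trigSpan (Set.univ : Set (Fin d → ℤ)), ∀ x, ‖f x - h x‖ ≤ ε := by
  have hpi : (2 * Real.pi) ≠ 0 := by positivity
  let q : C(Fin d → ℝ, UnitAddTorus (Fin d)) :=
    ⟨Pi.map fun _ (t : ℝ) => (t : UnitAddCircle),
      Continuous.piMap fun _ => AddCircle.continuous_mk' 1⟩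
  have hq : IsOpenQuotientMap q :=
    IsOpenQuotientMap.piMap fun _ => QuotientAddGroup.isOpenQuotientMap_mk
  let F₀ : C(Fin d → ℝ, ℂ) := ⟨fun x => f ((2 * Real.pi) • x), by fun_prop⟩
  have hF₀ : Function.FactorsThrough F₀ q := by
    intro x y hxy
    have h : ∀ i, ∃ n : ℤ, n • (1 : ℝ) = x i - y i := fun i => by
      rw [← AddCircle.coe_eq_zero_iff, AddCircle.coe_sub, sub_eq_zero]
      exact congr_fun hxy i
    choose n hn using h
    have : (2 * Real.pi) • x = (2 * Real.pi) • y + latt n := by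
      funext i
      have := hn i
      simp only [zsmul_eq_mul, mul_one] at this
      simp [latt, this]
      ring
    change f ((2 * Real.pi) • x) = f ((2 * Real.pi) • y)
    rw [this, hp]
  let F := hq.isQuotientMap.lift F₀ hF₀
  have hF : ∀ x, F (q x) = f ((2 * Real.pi) • x) := fun x =>
    congrArg (fun G : C(Fin d → ℝ, ℂ) => G x) (hq.isQuotientMap.lift_comp F₀ hF₀)
  let L : C(UnitAddTorus (Fin d), ℂ) →ₗ[ℂ] (Vd d → ℂ) :=
    { toFun := fun G x => G (q ((2 * Real.pi)⁻¹ • x))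
      map_add' := fun _ _ => rfl
      map_smul' := fun _ _ => rfl }
  have hL : ∀ k, L (UnitAddTorus.mFourier k) = tchar k := by
    intro k
    funext x
    rw [tchar_eq_prod]
    change ∏ i, fourier (k i) (((2 * Real.pi)⁻¹ * x i : ℝ) : UnitAddCircle) = _
    refine Finset.prod_congr rfl fun i _ => ?_
    rw [fourier_coe_apply]
    congr 1
    have : (Real.pi : ℂ) ≠ 0 := by simp [Real.pi_ne_zero]
    push_cast
    field_simp
  have hmem : F ∈ closure (Submodule.span ℂ (Set.range (UnitAddTorus.mFourier (d := Fin d))) :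
      Set C(UnitAddTorus (Fin d), ℂ)) := by
    rw [← Submodule.topologicalClosure_coe, UnitAddTorus.span_mFourier_closure_eq_top]
    trivial
  obtain ⟨G, hG, hFG⟩ := Metric.mem_closure_iff.mp hmem ε hε
  refine ⟨L G, ?_, fun x => ?_⟩
  · have : Submodule.span ℂ (Set.range (UnitAddTorus.mFourier (d := Fin d))) ≤
        (trigSpan Set.univ).comap L := by
      rw [Submodule.span_le]
      rintro _ ⟨k, rfl⟩
      change L _ ∈ trigSpan Set.univ
      rw [hL]
      exact tchar_mem_trigSpan (Set.mem_univ k)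
    exact this hG
  · have h1 : f x = F (q ((2 * Real.pi)⁻¹ • x)) := by rw [hF, smul_inv_smul₀ hpi]
    rw [h1, ← dist_eq_norm]
    exact (ContinuousMap.dist_apply_le_dist _).trans hFG.le

end Approximation

/-- The symbol `k ↦ φ(k/λ)` on `ℤ^d` obtained by dilating and sampling `φ`. -/
def dilSymbol {d : ℕ} (φ : EuclideanSpace ℝ (Fin d) → ℂ) (lam : ℝ) (k : Fin d → ℤ) : ℂ :=
  φ (WithLp.toLp 2 fun i => (k i : ℝ) / lam)

section Multipliers

open FourierTransform SchwartzMap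

variable {d : ℕ} {φ : EuclideanSpace ℝ (Fin d) → ℂ} {lam : ℝ}

lemma finite_dilSymbol_ne_zero (hφ : HasCompactSupport φ) (hlam : 0 < lam) :
    {k | dilSymbol φ lam k ≠ 0}.Finite := by
  obtain ⟨R, hR⟩ := hφ.isCompact.isBounded.exists_norm_le
  obtain ⟨N, hN⟩ := exists_nat_ge (R * lam)
  refine (Set.finite_Icc (fun _ => -(N : ℤ)) (fun _ => (N : ℤ))).subset fun k hk => ?_
  have hkR := hR _ (subset_tsupport φ (Function.mem_support.mpr hk))
  have h : ∀ i, |k i| ≤ (N : ℤ) := fun i => by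
    have h1 := (PiLp.norm_apply_le (WithLp.toLp 2 fun i => (k i : ℝ) / lam) i).trans hkR
    simp only [Real.norm_eq_abs, abs_div, abs_of_pos hlam] at h1
    have h2 := ((div_le_iff₀ hlam).mp h1).trans hN
    exact_mod_cast h2
  exact ⟨fun i => (abs_le.mp (h i)).1, fun i => (abs_le.mp (h i)).2⟩

lemma integral_fourierInv_mul_tchar (Φ : 𝓢(EuclideanSpace ℝ (Fin d), ℂ)) (lam : ℝ)
    (k : Fin d → ℤ) (x : Vd d) :
    ∫ y, (𝓕⁻ Φ) y * tchar k (x - (2 * Real.pi / lam) • y.ofLp)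
      = dilSymbol Φ lam k * tchar k x := by
  have h : Φ (WithLp.toLp 2 fun i => (k i : ℝ) / lam)
      = 𝓕 ((𝓕⁻ Φ : 𝓢(EuclideanSpace ℝ (Fin d), ℂ)) : EuclideanSpace ℝ (Fin d) → ℂ)
        (WithLp.toLp 2 fun i => (k i : ℝ) / lam) := by
    rw [← SchwartzMap.fourier_coe, FourierTransform.fourier_fourierInv_eq]
  rw [dilSymbol, h, Real.fourier_eq', ← integral_mul_const]
  refine integral_congr_ae (Filter.Eventually.of_forall fun y => ?_)
  simp only [smul_eq_mul]
  rw [sub_eq_add_neg, tchar_add_right, ← neg_smul]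
  have : tchar k (-(2 * Real.pi / lam) • y.ofLp) = Complex.exp
      (((-2 * Real.pi * inner ℝ y (WithLp.toLp 2 fun i => (k i : ℝ) / lam) : ℝ) : ℂ)
        * Complex.I) := by
    rw [tchar, dotZ_smul_right, mul_comm Complex.I]
    congr 3
    simp only [dotZ, PiLp.inner_apply, RCLike.inner_apply, conj_trivial, Finset.mul_sum]
    refine Finset.sum_congr rfl fun i _ => ?_
    ring
  rw [this]
  ring

lemma integrable_mul_translate (K : 𝓢(EuclideanSpace ℝ (Fin d), ℂ)) {f : Vd d → ℂ}
    (hf : Continuous f) {M : ℝ} (hM : ∀ x, ‖f x‖ ≤ M) (r : ℝ) (x : Vd d) :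
    Integrable fun y : EuclideanSpace ℝ (Fin d) => K y * f (x - r • y.ofLp) := by
  refine K.integrable.mul_bdd (c := M) ?_ (Filter.Eventually.of_forall fun y => hM _)
  exact Continuous.aestronglyMeasurable (by fun_prop)

lemma norm_integral_mul_translate_le (K : 𝓢(EuclideanSpace ℝ (Fin d), ℂ)) {f : Vd d → ℂ}
    {M : ℝ} (hM : ∀ x, ‖f x‖ ≤ M) (r : ℝ) (x : Vd d) :
    ‖∫ y, K y * f (x - r • y.ofLp)‖ ≤ (∫ y, ‖K y‖) * M := by
  rw [← integral_mul_const]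
  refine norm_integral_le_of_norm_le (K.integrable.norm.mul_const M)
    (Filter.Eventually.of_forall fun y => ?_)
  rw [norm_mul]
  exact mul_le_mul_of_nonneg_left (hM _) (norm_nonneg _)

lemma exists_norm_le_of_torusFun {F : Type*} [NormedAddCommGroup F] {f : Vd d → F}
    (hf : Continuous f) (hp : TorusFun f) : ∃ M, ∀ x, ‖f x‖ ≤ M := by
  obtain ⟨M, hM⟩ := isCompact_Icc.exists_bound_of_continuousOn (s := box d) hf.continuousOn
  refine ⟨M, fun x => ?_⟩
  have hpi : (0 : ℝ) < 2 * Real.pi := by positivity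
  rw [← hp x fun i => -⌊x i / (2 * Real.pi)⌋]
  refine hM _ ⟨fun i => ?_, fun i => ?_⟩
  · have := (le_div_iff₀ hpi).mp (Int.floor_le (x i / (2 * Real.pi)))
    simp only [Pi.zero_apply, Pi.add_apply, latt, Int.cast_neg]
    linarith
  · have := (div_lt_iff₀ hpi).mp (Int.lt_floor_add_one (x i / (2 * Real.pi)))
    simp only [Pi.add_apply, latt, Int.cast_neg]
    linarith

lemma torusFun_tchar (k : Fin d → ℤ) : TorusFun (tchar k) := by
  intro x m
  rw [tchar_add_right]
  have : tchar k (latt m) = 1 := by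
    rw [tchar, Complex.exp_eq_one_iff]
    refine ⟨∑ i, k i * m i, ?_⟩
    simp only [dotZ, latt]
    push_cast
    rw [Finset.mul_sum, Finset.sum_mul]
    exact Finset.sum_congr rfl fun i _ => by ring
  rw [this, mul_one]

lemma torusFun_of_mem_trigSpan {s : Set (Fin d → ℤ)} {h : Vd d → ℂ} (hh : h ∈ trigSpan s) :
    TorusFun h := by
  obtain ⟨u, c, -, rfl⟩ := exists_of_mem_trigSpan hh
  intro x m
  simp only [Finset.sum_apply, Pi.smul_apply]
  exact Finset.sum_congr rfl fun k _ => by rw [torusFun_tchar]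

/-- A multiplier with a dilated compactly supported smooth symbol is an average of translates. -/
lemma fmul_dilSymbol_eq_integral (Φ : 𝓢(EuclideanSpace ℝ (Fin d), ℂ)) (hΦ : HasCompactSupport Φ)
    (hlam : 0 < lam) {f : Vd d → ℂ} (hf : Continuous f) (hp : TorusFun f) (x : Vd d) :
    fmul (dilSymbol Φ lam) f x = ∫ y, (𝓕⁻ Φ) y * f (x - (2 * Real.pi / lam) • y.ofLp) := by
  set r := 2 * Real.pi / lam with hr
  obtain ⟨u, hu⟩ := (finite_dilSymbol_ne_zero hΦ hlam).exists_finset_coe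
  have hu0 : ∀ k ∉ u, dilSymbol Φ lam k = 0 := fun k hk => by
    by_contra h
    exact hk (Finset.mem_coe.mp (hu ▸ h))
  have hsum : ∀ g : Vd d → ℂ, fmul (dilSymbol Φ lam) g x
      = ∑ k ∈ u, dilSymbol Φ lam k * fCoeff g k * tchar k x := fun g => by
    rw [fmul_eq_sum (u := u) fun k hk => by rw [hu0 k hk, zero_mul]]
    simp
  have htrig : ∀ g ∈ trigSpan (Set.univ : Set (Fin d → ℤ)),
      fmul (dilSymbol Φ lam) g x = ∫ y, (𝓕⁻ Φ) y * g (x - r • y.ofLp) := by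
    intro g hg
    obtain ⟨v, c, -, rfl⟩ := exists_of_mem_trigSpan hg
    rw [fmul_sum_tchar]
    simp only [Finset.sum_apply, Pi.smul_apply, smul_eq_mul, Finset.mul_sum]
    rw [integral_finsetSum]
    · refine Finset.sum_congr rfl fun k _ => ?_
      simp_rw [mul_left_comm _ (c k)]
      rw [integral_const_mul, integral_fourierInv_mul_tchar]
      ring
    · intro k _
      simp_rw [mul_left_comm _ (c k)]
      exact (integrable_mul_translate _ (continuous_tchar k)
        (fun x => (norm_tchar k x).le) r x).const_mul _
  obtain ⟨M, hM⟩ := exists_norm_le_of_torusFun hf hp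
  set C := (∑ k ∈ u, ‖dilSymbol Φ lam k‖) + ∫ y, ‖(𝓕⁻ Φ) y‖ with hC
  have hC0 : 0 ≤ C := by positivity
  rw [← sub_eq_zero, ← norm_le_zero_iff]
  refine le_of_forall_pos_le_add fun ε hε => ?_
  obtain ⟨g, hg, hfg⟩ := exists_trigSpan_approx hf hp (ε := ε / (C + 1)) (by positivity)
  have hgc := continuous_of_mem_trigSpan hg
  obtain ⟨N, hN⟩ := exists_norm_le_of_torusFun hgc (torusFun_of_mem_trigSpan hg)
  have h1 : ‖fmul (dilSymbol Φ lam) f x - fmul (dilSymbol Φ lam) g x‖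
      ≤ (∑ k ∈ u, ‖dilSymbol Φ lam k‖) * (ε / (C + 1)) := by
    rw [hsum, hsum, ← Finset.sum_sub_distrib, Finset.sum_mul]
    refine norm_sum_le_of_le _ fun k _ => ?_
    rw [← sub_mul, ← mul_sub, ← fCoeff_sub hf hgc, norm_mul, norm_mul, norm_tchar, mul_one]
    exact mul_le_mul_of_nonneg_left (norm_fCoeff_le hfg k) (norm_nonneg _)
  have h2 : ‖(∫ y, (𝓕⁻ Φ) y * f (x - r • y.ofLp)) - ∫ y, (𝓕⁻ Φ) y * g (x - r • y.ofLp)‖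
      ≤ (∫ y, ‖(𝓕⁻ Φ) y‖) * (ε / (C + 1)) := by
    rw [← integral_sub (integrable_mul_translate _ hf hM r x)
      (integrable_mul_translate _ hgc hN r x)]
    simp_rw [← mul_sub]
    exact norm_integral_mul_translate_le (𝓕⁻ Φ) (f := f - g) hfg r x
  calc _ = ‖(fmul (dilSymbol Φ lam) f x - fmul (dilSymbol Φ lam) g x)
        - ((∫ y, (𝓕⁻ Φ) y * f (x - r • y.ofLp)) - ∫ y, (𝓕⁻ Φ) y * g (x - r • y.ofLp))‖ := by
        rw [htrig g hg]; congr 1; ring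
    _ ≤ C * (ε / (C + 1)) := by
        rw [hC, add_mul]; exact (norm_sub_le _ _).trans (add_le_add h1 h2)
    _ ≤ (C + 1) * (ε / (C + 1)) := by gcongr; linarith
    _ = 0 + ε := by field_simp; ring

/-- Dilated smooth multipliers are bounded in the sup norm, uniformly in the dilation. -/
lemma exists_norm_fmul_dilSymbol_le (hs : ContDiff ℝ (⊤ : ℕ∞) φ) (hc : HasCompactSupport φ) :
    ∃ C, 0 ≤ C ∧ ∀ lam : ℝ, 0 < lam → ∀ f : Vd d → ℂ, Continuous f → TorusFun f →
      ∀ M, (∀ x, ‖f x‖ ≤ M) → ∀ x, ‖fmul (dilSymbol φ lam) f x‖ ≤ C * M := by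
  refine ⟨∫ y, ‖(𝓕⁻ (hc.toSchwartzMap hs)) y‖, by positivity,
    fun lam hlam f hf hp M hM x => ?_⟩
  have := fmul_dilSymbol_eq_integral (hc.toSchwartzMap hs) hc hlam hf hp x
  exact (congrArg norm this).trans_le (norm_integral_mul_translate_le _ hM _ x)

/-- Dilated smooth multipliers vanishing at the origin gain `λ^{-α}` on Hölder functions. -/
lemma exists_norm_fmul_dilSymbol_le_holder (hs : ContDiff ℝ (⊤ : ℕ∞) φ)
    (hc : HasCompactSupport φ) (h0 : φ 0 = 0) {α : ℝ} (hα0 : 0 < α) (hα1 : α < 1) :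
    ∃ C, 0 ≤ C ∧ ∀ lam : ℝ, 0 < lam → ∀ f : Vd d → ℂ, Continuous f → TorusFun f →
      ∀ H, 0 ≤ H → (∀ x y, ‖f x - f y‖ ≤ H * ‖x - y‖ ^ α) →
        ∀ x, ‖fmul (dilSymbol φ lam) f x‖ ≤ C * lam ^ (-α) * H := by
  set K := 𝓕⁻ (hc.toSchwartzMap hs) with hK
  have hint : Integrable fun y => ‖K y‖ * (1 + ‖y‖) := by
    have h1 := K.integrable_pow_mul volume 1
    simp only [pow_one] at h1
    simp_rw [mul_add, mul_one, mul_comm ‖K _‖]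
    exact K.integrable.norm.add h1
  refine ⟨(2 * Real.pi) ^ α * ∫ y, ‖K y‖ * (1 + ‖y‖), by positivity,
    fun lam hlam f hf hp H hH hfH x => ?_⟩
  set r := 2 * Real.pi / lam with hr
  obtain ⟨M, hM⟩ := exists_norm_le_of_torusFun hf hp
  have hzero : ∫ y, K y = 0 := by
    have := integral_fourierInv_mul_tchar (hc.toSchwartzMap hs) 1 0 0
    simp only [tchar_zero, Pi.one_apply, mul_one] at this
    rw [this]
    have h00 : (WithLp.toLp 2 fun i => (((0 : Fin d → ℤ) i : ℤ) : ℝ) / 1)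
        = (0 : EuclideanSpace ℝ (Fin d)) := by
      ext i; simp
    rw [dilSymbol, h00]
    exact h0
  have hrep : fmul (dilSymbol φ lam) f x = ∫ y, K y * (f (x - r • y.ofLp) - f x) := by
    have h1 := fmul_dilSymbol_eq_integral (hc.toSchwartzMap hs) hc hlam hf hp x
    refine Eq.trans h1 ?_
    simp_rw [mul_sub]
    rw [integral_sub (integrable_mul_translate _ hf hM r x) (K.integrable.mul_const _),
      integral_mul_const, hzero, zero_mul, sub_zero]
  have hr0 : 0 < r := by positivity
  rw [hrep]
  have hbound : ‖∫ y, K y * (f (x - r • y.ofLp) - f x)‖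
      ≤ ∫ y, ‖K y‖ * (1 + ‖y‖) * (H * r ^ α) := by
    refine norm_integral_le_of_norm_le (hint.mul_const _)
      (Filter.Eventually.of_forall fun y => ?_)
    rw [norm_mul, mul_assoc]
    refine mul_le_mul_of_nonneg_left ?_ (norm_nonneg _)
    have hy : ‖y.ofLp‖ ≤ ‖y‖ :=
      (pi_norm_le_iff_of_nonneg (norm_nonneg y)).mpr fun i => PiLp.norm_apply_le y i
    have hpow : ‖y‖ ^ α ≤ 1 + ‖y‖ := by
      refine (Real.rpow_le_rpow (norm_nonneg y) (by linarith : ‖y‖ ≤ 1 + ‖y‖) hα0.le).trans ?_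
      exact Real.rpow_le_self_of_one_le (by linarith [norm_nonneg y]) hα1.le
    calc ‖f (x - r • y.ofLp) - f x‖ ≤ H * ‖x - r • y.ofLp - x‖ ^ α := hfH _ _
      _ ≤ H * (r * ‖y‖) ^ α := by
        rw [sub_sub_cancel_left, norm_neg, norm_smul, Real.norm_of_nonneg hr0.le]
        gcongr
      _ = H * r ^ α * ‖y‖ ^ α := by rw [Real.mul_rpow hr0.le (norm_nonneg _)]; ring
      _ ≤ H * r ^ α * (1 + ‖y‖) := by gcongr
      _ = _ := by ring
  rw [integral_mul_const] at hbound
  refine hbound.trans_eq ?_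
  rw [hr, Real.div_rpow (by positivity) hlam.le, Real.rpow_neg hlam.le]
  ring

end Multipliers

/-- The annular cutoff `ξ ↦ ψ(aξ) - ψ(bξ)`, as a function on Euclidean space. -/
def annCutoff {d : ℕ} (ψ : Vd d → ℝ) (a b : ℝ) (ξ : EuclideanSpace ℝ (Fin d)) : ℂ :=
  ((ψ (a • ξ.ofLp) - ψ (b • ξ.ofLp) : ℝ) : ℂ)

/-- Frequencies in the annulus `(3/8)λ ≤ |k| ≤ 2λ`. -/
def freqAnnulus (d : ℕ) (lam : ℝ) : Set (Fin d → ℤ) :=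
  {k | 3 / 8 * lam ≤ kAbs k ∧ kAbs k ≤ 2 * lam}

section Symbols

variable {d : ℕ} {ψ : Vd d → ℝ}

lemma eNorm_ofLp (ξ : EuclideanSpace ℝ (Fin d)) : eNorm ξ.ofLp = ‖ξ‖ := by
  simp [eNorm, EuclideanSpace.norm_eq]

lemma eNorm_smul (c : ℝ) (x : Vd d) : eNorm (c • x) = |c| * eNorm x := by
  have := norm_smul c (WithLp.toLp 2 x : EuclideanSpace ℝ (Fin d))
  rw [← eNorm_ofLp, ← eNorm_ofLp] at this
  exact this

lemma contDiff_annCutoff (hψ : LPfun ψ) (a b : ℝ) :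
    ContDiff ℝ (⊤ : ℕ∞) (annCutoff ψ a b) := by
  have h : ContDiff ℝ (⊤ : ℕ∞) fun ξ : EuclideanSpace ℝ (Fin d) => ξ.ofLp :=
    PiLp.contDiff_ofLp
  exact Complex.ofRealCLM.contDiff.comp
    ((hψ.smooth.comp (h.const_smul a)).sub (hψ.smooth.comp (h.const_smul b)))

lemma hasCompactSupport_of_norm_le {F : Type*} [Zero F] {φ : EuclideanSpace ℝ (Fin d) → F}
    {R : ℝ} (h : ∀ ξ, R ≤ ‖ξ‖ → φ ξ = 0) : HasCompactSupport φ :=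
  HasCompactSupport.intro (isCompact_closedBall 0 R) fun ξ hξ => h ξ <| by
    rw [mem_closedBall_zero_iff, not_le] at hξ
    exact hξ.le

lemma LPfun.eq_zero_of_le (hψ : LPfun ψ) {a : ℝ} (ha : 0 ≤ a) {ξ : EuclideanSpace ℝ (Fin d)}
    (h : 3 / 2 ≤ a * ‖ξ‖) : ψ (a • ξ.ofLp) = 0 :=
  hψ.supp _ (by rwa [eNorm_smul, eNorm_ofLp, abs_of_nonneg ha])

lemma LPfun.eq_one_of_le (hψ : LPfun ψ) {a : ℝ} (ha : 0 ≤ a) {ξ : EuclideanSpace ℝ (Fin d)}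
    (h : a * ‖ξ‖ ≤ 1) : ψ (a • ξ.ofLp) = 1 :=
  hψ.one _ (by rwa [eNorm_smul, eNorm_ofLp, abs_of_nonneg ha])

lemma hasCompactSupport_annCutoff (hψ : LPfun ψ) {a b : ℝ} (ha : 0 < a) (hab : a ≤ b) :
    HasCompactSupport (annCutoff ψ a b) := by
  refine hasCompactSupport_of_norm_le (R := 3 / 2 / a) fun ξ hξ => ?_
  rw [div_le_iff₀ ha, mul_comm] at hξ
  rw [annCutoff, hψ.eq_zero_of_le ha.le hξ,
    hψ.eq_zero_of_le (ha.le.trans hab) (hξ.trans (by gcongr)), sub_zero, Complex.ofReal_zero]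

lemma annCutoff_eq_zero_of_le (hψ : LPfun ψ) {a b : ℝ} (ha : 0 ≤ a) (hab : a ≤ b)
    {ξ : EuclideanSpace ℝ (Fin d)} (h : b * ‖ξ‖ ≤ 1) : annCutoff ψ a b ξ = 0 := by
  rw [annCutoff, hψ.eq_one_of_le (ha.trans hab) h, hψ.eq_one_of_le ha (le_trans (by gcongr) h),
    sub_self, Complex.ofReal_zero]

lemma annCutoff_eq_one (hψ : LPfun ψ) {ξ : EuclideanSpace ℝ (Fin d)}
    (h₁ : 3 / 8 ≤ ‖ξ‖) (h₂ : ‖ξ‖ ≤ 2) : annCutoff ψ (1 / 2) 4 ξ = 1 := by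
  rw [annCutoff, hψ.eq_one_of_le (by norm_num) (by linarith),
    hψ.eq_zero_of_le (by norm_num) (by linarith), sub_zero, Complex.ofReal_one]

lemma norm_toLp_div (k : Fin d → ℤ) {lam : ℝ} (hlam : 0 < lam) :
    ‖(WithLp.toLp 2 fun i => (k i : ℝ) / lam : EuclideanSpace ℝ (Fin d))‖ = kAbs k / lam := by
  have h : (fun i => (k i : ℝ) / lam) = lam⁻¹ • fun i => (k i : ℝ) := by
    funext i
    simp [div_eq_inv_mul]
  rw [← eNorm_ofLp]
  change eNorm (fun i => (k i : ℝ) / lam) = _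
  rw [h, eNorm_smul, abs_of_pos (inv_pos.mpr hlam), inv_mul_eq_div]
  rfl

lemma dilSymbol_annCutoff_eq_one (hψ : LPfun ψ) {lam : ℝ} (hlam : 0 < lam) {k : Fin d → ℤ}
    (hk : k ∈ freqAnnulus d lam) : dilSymbol (annCutoff ψ (1 / 2) 4) lam k = 1 := by
  refine annCutoff_eq_one hψ ?_ ?_
  · rw [norm_toLp_div k hlam, le_div_iff₀ hlam]
    exact hk.1
  · rw [norm_toLp_div k hlam, div_le_iff₀ hlam]
    exact hk.2

lemma contDiff_norm_rpow_mul_annCutoff (hψ : LPfun ψ) (s : ℝ) :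
    ContDiff ℝ (⊤ : ℕ∞) fun ξ => ((‖ξ‖ ^ s : ℝ) : ℂ) * annCutoff ψ (1 / 2) 4 ξ := by
  rw [contDiff_iff_contDiffAt]
  intro ξ
  by_cases hξ : ξ = 0
  · have h : (fun ξ => ((‖ξ‖ ^ s : ℝ) : ℂ) * annCutoff ψ (1 / 2) 4 ξ) =ᶠ[nhds ξ] fun _ => 0 := by
      filter_upwards [Metric.ball_mem_nhds ξ (show (0 : ℝ) < 1 / 4 by norm_num)] with η hη
      rw [hξ, mem_ball_zero_iff] at hη
      rw [annCutoff_eq_zero_of_le hψ (by norm_num) (by norm_num) (by linarith), mul_zero]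
    exact contDiffAt_const.congr_of_eventuallyEq h
  · exact (Complex.ofRealCLM.contDiff.contDiffAt.comp ξ ((contDiffAt_norm ℝ hξ).rpow_const_of_ne
      (norm_ne_zero_iff.mpr hξ))).mul (contDiff_annCutoff hψ _ _).contDiffAt

lemma fmul_const_mul (c : ℂ) (m : (Fin d → ℤ) → ℂ) (f : Vd d → ℂ) :
    fmul (fun k => c * m k) f = c • fmul m f := by
  funext x
  simp only [fmul, Pi.smul_apply, smul_eq_mul, ← tsum_mul_left]
  exact tsum_congr fun k => by ring

lemma kAbs_zero : kAbs (0 : Fin d → ℤ) = 0 := by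
  simp [kAbs, eNorm]

/-- On functions with frequencies of size `λ`, the operator `Λ^s` costs a factor `λ^s`. -/
lemma exists_norm_LamPow_le (hψ : LPfun ψ) (s : ℝ) :
    ∃ C, 0 ≤ C ∧ ∀ lam : ℝ, 0 < lam → ∀ h ∈ trigSpan (freqAnnulus d lam),
      ∀ M, (∀ x, ‖h x‖ ≤ M) → ∀ x, ‖LamPow s h x‖ ≤ C * lam ^ s * M := by
  obtain ⟨C, hC0, hC⟩ := exists_norm_fmul_dilSymbol_le (contDiff_norm_rpow_mul_annCutoff hψ s)
    ((hasCompactSupport_annCutoff hψ (by norm_num) (by norm_num)).mul_left)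
  refine ⟨C, hC0, fun lam hlam h hh M hM x => ?_⟩
  have heq : LamPow s h = ((lam ^ s : ℝ) : ℂ) •
      fmul (dilSymbol (fun ξ => ((‖ξ‖ ^ s : ℝ) : ℂ) * annCutoff ψ (1 / 2) 4 ξ) lam) h := by
    rw [← fmul_const_mul]
    refine fmul_congr_of_mem_trigSpan hh fun k hk => ?_
    have hpos : 0 < kAbs k := lt_of_lt_of_le (by positivity) hk.1
    have hk0 : k ≠ 0 := by
      rintro rfl
      exact hpos.ne' kAbs_zero
    have h1 := dilSymbol_annCutoff_eq_one hψ hlam hk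
    rw [dilSymbol] at h1 ⊢
    rw [if_neg hk0, h1, mul_one, norm_toLp_div k hlam, ← Complex.ofReal_mul,
      ← Real.mul_rpow hlam.le (by positivity), mul_div_cancel₀ _ hlam.ne']
  rw [heq, Pi.smul_apply, norm_smul, Complex.norm_real, Real.norm_of_nonneg (by positivity),
    mul_comm C, mul_assoc]
  gcongr
  exact hC lam hlam h (continuous_of_mem_trigSpan hh) (torusFun_of_mem_trigSpan hh) M hM x

lemma hasDerivAt_tchar_line (k : Fin d → ℤ) (x z : Vd d) (t : ℝ) :
    HasDerivAt (fun t : ℝ => tchar k (x + t • z))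
      (Complex.I * (dotZ k z : ℂ) * tchar k (x + t • z)) t := by
  have h1 : HasDerivAt (fun t : ℝ => dotZ k (x + t • z)) (dotZ k z) t := by
    simp_rw [dotZ_add_right, dotZ_smul_right]
    simpa using ((hasDerivAt_id t).mul_const (dotZ k z)).const_add (dotZ k x)
  have h2 := (h1.ofReal_comp.const_mul Complex.I).cexp
  rw [mul_comm]
  exact h2

lemma hasDerivAt_line_of_mem_trigSpan {s : Set (Fin d → ℤ)} {h : Vd d → ℂ}
    (hh : h ∈ trigSpan s) (x z : Vd d) (t : ℝ) :
    HasDerivAt (fun t : ℝ => h (x + t • z))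
      (fmul (fun k => Complex.I * (dotZ k z : ℂ)) h (x + t • z)) t := by
  obtain ⟨u, c, -, rfl⟩ := exists_of_mem_trigSpan hh
  rw [fmul_sum_tchar]
  simp only [Finset.sum_apply, Pi.smul_apply, smul_eq_mul]
  refine HasDerivAt.fun_sum fun k _ => ?_
  exact ((hasDerivAt_tchar_line k x z t).const_mul (c k)).congr_deriv (by ring)

lemma fmul_finsetSum_symbol {ι : Type*} {s : Set (Fin d → ℤ)} {h : Vd d → ℂ}
    (hh : h ∈ trigSpan s) (v : Finset ι) (m : ι → (Fin d → ℤ) → ℂ) :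
    fmul (fun k => ∑ i ∈ v, m i k) h = ∑ i ∈ v, fmul (m i) h := by
  obtain ⟨u, c, -, rfl⟩ := exists_of_mem_trigSpan hh
  simp only [fmul_sum_tchar, Finset.sum_mul, Finset.sum_smul]
  exact Finset.sum_comm

/-- Bernstein's inequality: functions with frequencies of size `λ` are Lipschitz with constant
`≲ λ`. -/
lemma exists_norm_sub_le_of_mem_trigSpan (hψ : LPfun ψ) :
    ∃ C, 0 ≤ C ∧ ∀ lam : ℝ, 0 < lam → ∀ h ∈ trigSpan (freqAnnulus d lam),
      ∀ M, (∀ x, ‖h x‖ ≤ M) → ∀ x y, ‖h x - h y‖ ≤ C * lam * M * ‖x - y‖ := by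
  have hi : ∀ i : Fin d, ∃ C, 0 ≤ C ∧ ∀ lam : ℝ, 0 < lam → ∀ f : Vd d → ℂ, Continuous f →
      TorusFun f → ∀ M, (∀ x, ‖f x‖ ≤ M) →
        ∀ x, ‖fmul (dilSymbol (fun ξ => (ξ.ofLp i : ℂ) * annCutoff ψ (1 / 2) 4 ξ) lam) f x‖
          ≤ C * M := fun i => by
    refine exists_norm_fmul_dilSymbol_le ?_
      ((hasCompactSupport_annCutoff hψ (by norm_num) (by norm_num)).mul_left)
    have hcoord : ContDiff ℝ (⊤ : ℕ∞) fun ξ : EuclideanSpace ℝ (Fin d) => ξ.ofLp i :=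
      contDiff_piLp_apply 2
    exact (Complex.ofRealCLM.contDiff.comp hcoord).mul (contDiff_annCutoff hψ _ _)
  choose C hC0 hC using hi
  refine ⟨∑ i, C i, Finset.sum_nonneg fun i _ => hC0 i, fun lam hlam h hh M hM x y => ?_⟩
  set z := x - y with hz
  have hM0 : 0 ≤ M := (norm_nonneg _).trans (hM 0)
  have hbound : ∀ w, ‖fmul (fun k => Complex.I * (dotZ k z : ℂ)) h w‖
      ≤ (∑ i, C i) * lam * M * ‖z‖ := by
    intro w
    have heq : fmul (fun k => Complex.I * (dotZ k z : ℂ)) h =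
        ∑ i : Fin d, (Complex.I * (z i * lam : ℝ)) •
        fmul (dilSymbol (fun ξ => (ξ.ofLp i : ℂ) * annCutoff ψ (1 / 2) 4 ξ) lam) h := by
      simp_rw [← fmul_const_mul]
      rw [← fmul_finsetSum_symbol hh]
      refine fmul_congr_of_mem_trigSpan hh fun k hk => ?_
      have h1 := dilSymbol_annCutoff_eq_one hψ hlam hk
      simp only [dilSymbol] at h1 ⊢
      have hl : (lam : ℂ) ≠ 0 := by exact_mod_cast hlam.ne'
      simp only [h1, dotZ]
      push_cast
      rw [Finset.mul_sum]
      refine Finset.sum_congr rfl fun i _ => ?_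
      field_simp
    rw [heq, Finset.sum_apply, Finset.sum_mul, Finset.sum_mul, Finset.sum_mul]
    refine norm_sum_le_of_le _ fun i _ => ?_
    rw [Pi.smul_apply, norm_smul, norm_mul, Complex.norm_I, one_mul, Complex.norm_real,
      norm_mul, Real.norm_of_nonneg hlam.le]
    refine (mul_le_mul (mul_le_mul_of_nonneg_right (norm_le_pi_norm z i) hlam.le)
      (hC i lam hlam h (continuous_of_mem_trigSpan hh) (torusFun_of_mem_trigSpan hh) M hM w)
      (norm_nonneg _) (by positivity)).trans_eq (by ring)
  have := norm_image_sub_le_of_norm_deriv_le_segment_01' (f := fun t : ℝ => h (y + t • z))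
    (fun t _ => (hasDerivAt_line_of_mem_trigSpan hh y z t).hasDerivWithinAt)
    (fun t _ => hbound _)
  simpa [hz] using this

end Symbols

/-- The low-frequency cutoff `ψ`, as a complex-valued function on Euclidean space. -/
def lowCutoff {d : ℕ} (ψ : Vd d → ℝ) (ξ : EuclideanSpace ℝ (Fin d)) : ℂ := (ψ ξ.ofLp : ℂ)

section Blocks

variable {d : ℕ} {ψ : Vd d → ℝ}

lemma contDiff_lowCutoff (hψ : LPfun ψ) : ContDiff ℝ (⊤ : ℕ∞) (lowCutoff ψ) :=
  Complex.ofRealCLM.contDiff.comp (hψ.smooth.comp PiLp.contDiff_ofLp)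

lemma lowCutoff_eq_zero_of_le (hψ : LPfun ψ) {ξ : EuclideanSpace ℝ (Fin d)}
    (h : 3 / 2 ≤ ‖ξ‖) : lowCutoff ψ ξ = 0 := by
  rw [lowCutoff, hψ.supp _ (by rwa [eNorm_ofLp]), Complex.ofReal_zero]

lemma hasCompactSupport_lowCutoff (hψ : LPfun ψ) : HasCompactSupport (lowCutoff ψ) :=
  hasCompactSupport_of_norm_le fun _ hξ => lowCutoff_eq_zero_of_le hψ hξ

lemma fmul_mem_trigSpan_of_finite {m : (Fin d → ℤ) → ℂ} (hm : {k | m k ≠ 0}.Finite)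
    {s : Set (Fin d → ℤ)} (hs : ∀ k, m k ≠ 0 → k ∈ s) (f : Vd d → ℂ) : fmul m f ∈ trigSpan s := by
  rw [fmul_eq_sum (u := hm.toFinset) fun k hk => by
    rw [Set.Finite.mem_toFinset, Set.mem_ofPred_eq, not_not] at hk
    rw [hk, zero_mul]]
  exact sum_mem_trigSpan fun k _ hc => hs k (left_ne_zero_of_mul hc)

lemma fmul_zero_right (m : (Fin d → ℤ) → ℂ) : fmul m 0 = 0 := by
  have := fmul_smul 0 m 0
  rwa [zero_smul, zero_smul] at this

lemma fmul_zero_left (f : Vd d → ℂ) : fmul (fun _ => 0) f = 0 := by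
  funext x
  simp [fmul]

lemma one_le_kAbs {k : Fin d → ℤ} (hk : k ≠ 0) : 1 ≤ kAbs k := by
  obtain ⟨i, hi⟩ := Function.ne_iff.mp hk
  have h1 : (1 : ℝ) ≤ |(k i : ℝ)| := by exact_mod_cast Int.one_le_abs hi
  have h2 := PiLp.norm_apply_le (WithLp.toLp 2 fun i => (k i : ℝ) : EuclideanSpace ℝ (Fin d)) i
  rw [← eNorm_ofLp, Real.norm_eq_abs] at h2
  exact h1.trans h2

lemma LPblock_eq_fmul {j : ℤ} (hj : 0 ≤ j) (f : Vd d → ℂ) :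
    LPblock ψ j f = fmul (dilSymbol (annCutoff ψ 1 2) ((2 : ℝ) ^ j)) f := by
  rw [LPblock, if_neg (by omega), if_neg (by omega)]
  funext x
  refine tsum_congr fun k => ?_
  rw [dilSymbol, annCutoff]
  have h1 : (1 : ℝ) • (fun i => (k i : ℝ) / (2 : ℝ) ^ j) = fun i => (k i : ℝ) / (2 : ℝ) ^ j :=
    one_smul _ _
  have h2 : (2 : ℝ) • (fun i => (k i : ℝ) / (2 : ℝ) ^ j)
      = fun i => (k i : ℝ) / (2 : ℝ) ^ (j - 1) := by
    funext i
    rw [Pi.smul_apply, smul_eq_mul, zpow_sub_one₀ two_ne_zero]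
    field_simp
  rw [h1, h2]

lemma LPlow_eq_zero {j : ℤ} (hj : j < -1) (f : Vd d → ℂ) : LPlow ψ j f = 0 := if_pos hj

lemma LPlow_eq_fmul (hψ : LPfun ψ) {j : ℤ} (hj : -1 ≤ j) (f : Vd d → ℂ) :
    LPlow ψ j f = fmul (dilSymbol (lowCutoff ψ) ((2 : ℝ) ^ j)) f := by
  rw [LPlow, if_neg (by omega)]
  split_ifs with h
  · subst h
    funext x
    rw [fmul, tsum_eq_single 0]
    · have h0 : lowCutoff ψ (WithLp.toLp 2 fun i => (((0 : Fin d → ℤ) i : ℤ) : ℝ) / 2 ^ (-1 : ℤ))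
          = 1 := by
        rw [lowCutoff, hψ.one _ (by simp [eNorm]), Complex.ofReal_one]
      rw [dilSymbol, h0]
      simp [dotZ]
    · intro k hk
      rw [dilSymbol, lowCutoff_eq_zero_of_le hψ, zero_mul, zero_mul]
      rw [norm_toLp_div k (by positivity), zpow_neg_one, div_inv_eq_mul]
      linarith [one_le_kAbs hk]
  · rfl

lemma finite_lowCutoff (hψ : LPfun ψ) (j : ℤ) :
    {k | dilSymbol (lowCutoff ψ) ((2 : ℝ) ^ j) k ≠ 0}.Finite :=
  finite_dilSymbol_ne_zero (hasCompactSupport_lowCutoff hψ) (by positivity)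

lemma finite_annCutoff (hψ : LPfun ψ) (j : ℤ) :
    {k | dilSymbol (annCutoff ψ 1 2) ((2 : ℝ) ^ j) k ≠ 0}.Finite :=
  finite_dilSymbol_ne_zero (hasCompactSupport_annCutoff hψ one_pos one_le_two) (by positivity)

lemma LPlow_mem_trigSpan (hψ : LPfun ψ) (j : ℤ) (f : Vd d → ℂ) :
    LPlow ψ j f ∈ trigSpan {k | kAbs k ≤ 3 / 2 * (2 : ℝ) ^ j} := by
  rcases lt_or_ge j (-1) with hj | hj
  · rw [LPlow_eq_zero hj]
    exact Submodule.zero_mem _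
  · rw [LPlow_eq_fmul hψ hj]
    refine fmul_mem_trigSpan_of_finite (finite_lowCutoff hψ j) (fun k hk => ?_) f
    contrapose! hk
    refine lowCutoff_eq_zero_of_le hψ ?_
    rw [Set.mem_ofPred_eq, not_le] at hk
    rw [norm_toLp_div k (by positivity), le_div_iff₀ (by positivity)]
    exact hk.le

lemma bounds_of_dilSymbol_annCutoff_ne_zero (hψ : LPfun ψ) {j : ℤ} {k : Fin d → ℤ}
    (hk : dilSymbol (annCutoff ψ 1 2) ((2 : ℝ) ^ j) k ≠ 0) :
    1 / 2 * (2 : ℝ) ^ j ≤ kAbs k ∧ kAbs k ≤ 3 / 2 * (2 : ℝ) ^ j := by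
  have hpos : (0 : ℝ) < 2 ^ j := by positivity
  have hn := norm_toLp_div k hpos
  constructor
  · contrapose! hk
    refine annCutoff_eq_zero_of_le hψ zero_le_one one_le_two ?_
    rw [hn, ← mul_div_assoc, div_le_one hpos]
    linarith
  · contrapose! hk
    rw [dilSymbol, annCutoff, hψ.eq_zero_of_le zero_le_one, hψ.eq_zero_of_le zero_le_two, sub_zero,
      Complex.ofReal_zero] <;>
    · rw [hn, ← mul_div_assoc, le_div_iff₀ hpos]
      linarith

lemma LPblock_mem_trigSpan (hψ : LPfun ψ) {j : ℤ} (hj : 0 ≤ j) (f : Vd d → ℂ) :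
    LPblock ψ j f ∈ trigSpan {k | 1 / 2 * (2 : ℝ) ^ j ≤ kAbs k ∧ kAbs k ≤ 3 / 2 * (2 : ℝ) ^ j} := by
  rw [LPblock_eq_fmul hj]
  exact fmul_mem_trigSpan_of_finite (finite_annCutoff hψ j)
    (fun k hk => bounds_of_dilSymbol_annCutoff_ne_zero hψ hk) f

lemma LPblock_mem_trigSpan_freqAnnulus (hψ : LPfun ψ) {j : ℤ} (hj : 0 ≤ j) (f : Vd d → ℂ) :
    LPblock ψ j f ∈ trigSpan (freqAnnulus d ((2 : ℝ) ^ j)) := by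
  refine trigSpan_mono (fun k hk => ?_) (LPblock_mem_trigSpan hψ hj f)
  have hpos : (0 : ℝ) < 2 ^ j := by positivity
  exact ⟨by linarith [hk.1], by linarith [hk.2]⟩

lemma LPlow_eq_add (hψ : LPfun ψ) {j : ℤ} (hj : 0 ≤ j) (f : Vd d → ℂ) :
    LPlow ψ j f = LPlow ψ (j - 1) f + LPblock ψ j f := by
  classical
  rw [LPlow_eq_fmul hψ (by omega), LPlow_eq_fmul hψ (by omega), LPblock_eq_fmul hj]
  have hadd : ∀ k : Fin d → ℤ, dilSymbol (lowCutoff ψ) ((2 : ℝ) ^ j) k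
      = dilSymbol (lowCutoff ψ) ((2 : ℝ) ^ (j - 1)) k
        + dilSymbol (annCutoff ψ 1 2) ((2 : ℝ) ^ j) k := fun k => by
    have h2 : (2 : ℝ) • (fun i => (k i : ℝ) / (2 : ℝ) ^ j)
        = fun i => (k i : ℝ) / (2 : ℝ) ^ (j - 1) := by
      funext i
      rw [Pi.smul_apply, smul_eq_mul, zpow_sub_one₀ two_ne_zero]
      field_simp
    simp only [dilSymbol, lowCutoff, annCutoff, one_smul, h2]
    push_cast
    ring
  have hlow := finite_lowCutoff hψ (j - 1)
  have hann := finite_annCutoff hψ j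
  funext x
  have key : ∀ m : (Fin d → ℤ) → ℂ, (∀ k ∉ hlow.toFinset ∪ hann.toFinset, m k = 0) →
      fmul m f = ∑ k ∈ hlow.toFinset ∪ hann.toFinset, (m k * fCoeff f k) • tchar k :=
    fun m hm => fmul_eq_sum fun k hk => by rw [hm k hk, zero_mul]
  have hk1 : ∀ k ∉ hlow.toFinset ∪ hann.toFinset,
      dilSymbol (lowCutoff ψ) ((2 : ℝ) ^ (j - 1)) k = 0 := fun k hk => by
    by_contra h
    exact hk (Finset.mem_union_left _ (hlow.mem_toFinset.mpr h))
  have hk2 : ∀ k ∉ hlow.toFinset ∪ hann.toFinset,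
      dilSymbol (annCutoff ψ 1 2) ((2 : ℝ) ^ j) k = 0 := fun k hk => by
    by_contra h
    exact hk (Finset.mem_union_right _ (hann.mem_toFinset.mpr h))
  rw [key _ hk1, key _ hk2, key _ fun k hk => by rw [hadd, hk1 k hk, hk2 k hk, add_zero],
    ← Finset.sum_add_distrib]
  simp_rw [hadd, add_mul, add_smul]

lemma exists_norm_LPlow_le (hψ : LPfun ψ) :
    ∃ C, 0 ≤ C ∧ ∀ g : Vd d → ℂ, Continuous g → TorusFun g → ∀ M, (∀ x, ‖g x‖ ≤ M) →
      ∀ (i : ℤ) (x : Vd d), ‖LPlow ψ i g x‖ ≤ C * M := by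
  obtain ⟨C, hC0, hC⟩ := exists_norm_fmul_dilSymbol_le (contDiff_lowCutoff hψ)
    (hasCompactSupport_lowCutoff hψ)
  refine ⟨C, hC0, fun g hg hp M hM i x => ?_⟩
  rcases lt_or_ge i (-1) with hi | hi
  · rw [LPlow_eq_zero hi, Pi.zero_apply, norm_zero]
    exact mul_nonneg hC0 ((norm_nonneg _).trans (hM 0))
  · rw [LPlow_eq_fmul hψ hi]
    exact hC _ (by positivity) g hg hp M hM x

lemma exists_norm_LPblock_le (hψ : LPfun ψ) :
    ∃ C, 0 ≤ C ∧ ∀ g : Vd d → ℂ, Continuous g → TorusFun g → ∀ M, (∀ x, ‖g x‖ ≤ M) →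
      ∀ j : ℤ, 0 ≤ j → ∀ x, ‖LPblock ψ j g x‖ ≤ C * M := by
  obtain ⟨C, hC0, hC⟩ := exists_norm_fmul_dilSymbol_le (contDiff_annCutoff hψ 1 2)
    (hasCompactSupport_annCutoff hψ one_pos one_le_two)
  refine ⟨C, hC0, fun g hg hp M hM j hj x => ?_⟩
  rw [LPblock_eq_fmul hj]
  exact hC _ (by positivity) g hg hp M hM x

lemma exists_norm_LPblock_le_holder (hψ : LPfun ψ) {α : ℝ} (hα0 : 0 < α) (hα1 : α < 1) :
    ∃ C, 0 ≤ C ∧ ∀ f : Vd d → ℂ, Continuous f → TorusFun f →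
      ∀ H, 0 ≤ H → (∀ x y, ‖f x - f y‖ ≤ H * ‖x - y‖ ^ α) →
        ∀ j : ℤ, 0 ≤ j → ∀ x, ‖LPblock ψ j f x‖ ≤ C * ((2 : ℝ) ^ j) ^ (-α) * H := by
  obtain ⟨C, hC0, hC⟩ := exists_norm_fmul_dilSymbol_le_holder (contDiff_annCutoff hψ 1 2)
    (hasCompactSupport_annCutoff hψ one_pos one_le_two)
    (annCutoff_eq_zero_of_le hψ zero_le_one one_le_two (by simp)) hα0 hα1
  refine ⟨C, hC0, fun f hf hp H hH hfH j hj x => ?_⟩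
  rw [LPblock_eq_fmul hj]
  exact hC _ (by positivity) f hf hp H hH hfH x

lemma exists_norm_Lam1_LPlow_le (hψ : LPfun ψ) :
    ∃ C, 0 ≤ C ∧ ∀ g : Vd d → ℂ, Continuous g → TorusFun g → ∀ M, (∀ x, ‖g x‖ ≤ M) →
      ∀ (i : ℤ) (x : Vd d), ‖Lam1 (LPlow ψ i g) x‖ ≤ C * (2 : ℝ) ^ i * M := by
  obtain ⟨A, hA0, hA⟩ := exists_norm_LPblock_le hψ
  obtain ⟨B, hB0, hB⟩ := exists_norm_LamPow_le hψ 1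
  refine ⟨2 * (B * A), by positivity, fun g hg hp M hM i x => ?_⟩
  have hM0 : 0 ≤ M := (norm_nonneg _).trans (hM 0)
  rcases lt_or_ge i (-1) with hi | hi
  · rw [LPlow_eq_zero hi, Lam1, LamPow, fmul_zero_right, Pi.zero_apply, norm_zero]
    positivity
  · induction i, hi using Int.leInduction with
    | base =>
      have h0 : Lam1 (LPlow ψ (-1) g) = 0 := by
        rw [← fmul_zero_left (LPlow ψ (-1) g)]
        refine fmul_congr_of_mem_trigSpan (LPlow_mem_trigSpan hψ (-1) g) fun k hk => ?_
        refine if_pos ?_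
        by_contra hk0
        have h1 := one_le_kAbs hk0
        rw [Set.mem_ofPred_eq, zpow_neg_one] at hk
        linarith
      rw [h0, Pi.zero_apply, norm_zero]
      positivity
    | succ i hi ih =>
      have hi0 : 0 ≤ i + 1 := by omega
      have hblock := LPblock_mem_trigSpan_freqAnnulus hψ hi0 g
      have h1 : Lam1 (LPlow ψ (i + 1) g) = Lam1 (LPlow ψ i g) + Lam1 (LPblock ψ (i + 1) g) := by
        rw [LPlow_eq_add hψ hi0, add_sub_cancel_right]
        exact fmul_add_of_mem_trigSpan (LPlow_mem_trigSpan hψ i g) hblock _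
      have h2 := hB _ (by positivity) _ hblock _ (hA g hg hp M hM _ hi0) x
      rw [Real.rpow_one] at h2
      rw [h1, Pi.add_apply]
      refine (norm_add_le _ _).trans ((add_le_add ih h2).trans_eq ?_)
      rw [zpow_add_one₀ two_ne_zero]
      ring

end Blocks

section FrequencyLocalization

variable {d : ℕ} {ψ : Vd d → ℝ}

lemma kAbs_eq_norm (k : Fin d → ℤ) :
    kAbs k = ‖(WithLp.toLp 2 fun i => (k i : ℝ) : EuclideanSpace ℝ (Fin d))‖ := by
  rw [← eNorm_ofLp]
  rfl

lemma kAbs_add_le (k m : Fin d → ℤ) : kAbs (k + m) ≤ kAbs k + kAbs m := by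
  have h : (WithLp.toLp 2 fun i => ((k + m) i : ℝ) : EuclideanSpace ℝ (Fin d))
      = WithLp.toLp 2 (fun i => (k i : ℝ)) + WithLp.toLp 2 fun i => (m i : ℝ) := by
    ext i
    simp
  rw [kAbs_eq_norm, kAbs_eq_norm, kAbs_eq_norm, h]
  exact norm_add_le _ _

lemma kAbs_neg (k : Fin d → ℤ) : kAbs (-k) = kAbs k := by
  simp [kAbs, eNorm]

lemma kAbs_sub_le_kAbs_add (k m : Fin d → ℤ) : kAbs k - kAbs m ≤ kAbs (k + m) := by
  have := kAbs_add_le (k + m) (-m)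
  rw [kAbs_neg, add_neg_cancel_right] at this
  linarith

lemma mul_mem_trigSpan_freqAnnulus {i j : ℤ} (hij : i ≤ j - 4) {F G : Vd d → ℂ}
    (hF : F ∈ trigSpan {k | 1 / 2 * (2 : ℝ) ^ j ≤ kAbs k ∧ kAbs k ≤ 3 / 2 * (2 : ℝ) ^ j})
    (hG : G ∈ trigSpan {k | kAbs k ≤ 3 / 2 * (2 : ℝ) ^ i}) :
    F * G ∈ trigSpan (freqAnnulus d ((2 : ℝ) ^ j)) := by
  refine mul_mem_trigSpan hF hG fun k hk m hm => ?_
  have hpos : (0 : ℝ) < 2 ^ j := by positivity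
  have h : (2 : ℝ) ^ i ≤ 2 ^ j / 16 := by
    refine (zpow_le_zpow_right₀ one_le_two hij).trans_eq ?_
    rw [zpow_sub₀ two_ne_zero]
    norm_num
  have h1 := kAbs_add_le k m
  have h2 := kAbs_sub_le_kAbs_add k m
  have hm' : kAbs m ≤ 3 / 2 * (2 : ℝ) ^ i := hm
  exact ⟨by linarith [hk.1], by linarith [hk.2]⟩

end FrequencyLocalization

section Bilinear

variable {ψ : Vd 2 → ℝ}

lemma Tbil_integrand_mem_trigSpan (hψ : LPfun ψ) {i j : ℤ} (hj : 0 ≤ j) (hij : i ≤ j - 4)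
    (f g : Vd 2 → ℂ) :
    Lam1 (LPblock ψ j f) * LPlow ψ i g - LPblock ψ j f * Lam1 (LPlow ψ i g)
      ∈ trigSpan (freqAnnulus 2 ((2 : ℝ) ^ j)) := by
  have hF := LPblock_mem_trigSpan hψ hj f
  have hG := LPlow_mem_trigSpan hψ i g
  exact Submodule.sub_mem _ (mul_mem_trigSpan_freqAnnulus hij (fmul_mem_trigSpan hF _) hG)
    (mul_mem_trigSpan_freqAnnulus hij hF (fmul_mem_trigSpan hG _))

lemma Tbil_zero_right (f : Vd 2 → ℂ) : Tbil f 0 = 0 := by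
  have h : (fun x => Lam1 f x * (0 : Vd 2 → ℂ) x - f x * Lam1 (0 : Vd 2 → ℂ) x) = 0 := by
    funext x
    simp [Lam1, LamPow, fmul_zero_right]
  rw [Tbil, h, LamPow, fmul_zero_right]

lemma Tbil_swap (f g : Vd 2 → ℂ) : Tbil f g = -Tbil g f := by
  have h : (fun x => Lam1 f x * g x - f x * Lam1 g x)
      = (-1 : ℂ) • fun x => Lam1 g x * f x - g x * Lam1 f x := by
    funext x
    simp only [Pi.smul_apply, smul_eq_mul]
    ring
  rw [Tbil, h, LamPow, fmul_smul, neg_one_smul]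
  rfl

lemma Tbil_LPblock_LPlow_mem_trigSpan (hψ : LPfun ψ) {i j : ℤ} (hij : i ≤ j - 4)
    (f g : Vd 2 → ℂ) :
    Tbil (LPblock ψ j f) (LPlow ψ i g) ∈ trigSpan (freqAnnulus 2 ((2 : ℝ) ^ j)) := by
  rcases lt_or_ge j 0 with hj | hj
  · rw [LPlow_eq_zero (by omega), Tbil_zero_right]
    exact Submodule.zero_mem _
  · exact fmul_mem_trigSpan (Tbil_integrand_mem_trigSpan hψ hj hij f g) _

/-- Each term of the paraproduct is bounded by `2^{-jα}`. -/
lemma exists_norm_Tbil_LPblock_LPlow_le (hψ : LPfun ψ) {α : ℝ} (hα0 : 0 < α) (hα1 : α < 1) :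
    ∃ C, 0 ≤ C ∧ ∀ f g : Vd 2 → ℂ, Continuous f → TorusFun f → Continuous g → TorusFun g →
      ∀ H, 0 ≤ H → (∀ x y, ‖f x - f y‖ ≤ H * ‖x - y‖ ^ α) → ∀ M, (∀ x, ‖g x‖ ≤ M) →
        ∀ i j : ℤ, i ≤ j - 4 → ∀ x, ‖Tbil (LPblock ψ j f) (LPlow ψ i g) x‖
          ≤ C * (H * M) * ((2 : ℝ) ^ j) ^ (-α) := by
  obtain ⟨A, hA0, hA⟩ := exists_norm_LPblock_le_holder hψ hα0 hα1
  obtain ⟨L, hL0, hL⟩ := exists_norm_LPlow_le hψ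
  obtain ⟨L', hL'0, hL'⟩ := exists_norm_Lam1_LPlow_le hψ
  obtain ⟨P, hP0, hP⟩ := exists_norm_LamPow_le hψ 1
  obtain ⟨N, hN0, hN⟩ := exists_norm_LamPow_le hψ (-1)
  refine ⟨N * (A * (P * L + L')), by positivity,
    fun f g hf hfp hg hgp H hH hfH M hM i j hij x => ?_⟩
  have hM0 : 0 ≤ M := (norm_nonneg _).trans (hM 0)
  rcases lt_or_ge j 0 with hj | hj
  · rw [LPlow_eq_zero (by omega), Tbil_zero_right, Pi.zero_apply, norm_zero]
    positivity
  have hpos : (0 : ℝ) < 2 ^ j := by positivity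
  set w := ((2 : ℝ) ^ j) ^ (-α) with hw
  have hw0 : 0 ≤ w := by positivity
  have hij' : (2 : ℝ) ^ i ≤ 2 ^ j := zpow_le_zpow_right₀ one_le_two (by omega)
  have hF := hA f hf hfp H hH hfH j hj
  have hG := hL g hg hgp M hM i
  have hΛF := hP _ hpos _ (LPblock_mem_trigSpan_freqAnnulus hψ hj f) _ hF
  have hΛG : ∀ y, ‖Lam1 (LPlow ψ i g) y‖ ≤ L' * (2 : ℝ) ^ j * M := fun y =>
    (hL' g hg hgp M hM i y).trans (by gcongr)
  have hu : ∀ y, ‖(Lam1 (LPblock ψ j f) * LPlow ψ i g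
      - LPblock ψ j f * Lam1 (LPlow ψ i g)) y‖
        ≤ (2 : ℝ) ^ j * (A * (P * L + L') * (H * M) * w) := fun y => by
    rw [Pi.sub_apply, Pi.mul_apply, Pi.mul_apply]
    refine (norm_sub_le _ _).trans ?_
    rw [norm_mul, norm_mul]
    have h1 : ‖Lam1 (LPblock ψ j f) y‖ * ‖LPlow ψ i g y‖
        ≤ (P * ((2 : ℝ) ^ j) ^ (1 : ℝ) * (A * w * H)) * (L * M) := by
      gcongr
      · exact hΛF y
      · exact hG y
    have h2 : ‖LPblock ψ j f y‖ * ‖Lam1 (LPlow ψ i g) y‖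
        ≤ (A * w * H) * (L' * (2 : ℝ) ^ j * M) := by
      gcongr
      · exact hF y
      · exact hΛG y
    rw [Real.rpow_one] at h1
    refine (add_le_add h1 h2).trans_eq ?_
    ring
  refine (hN _ hpos _ (Tbil_integrand_mem_trigSpan hψ hj hij f g) _ hu x).trans_eq ?_
  rw [Real.rpow_neg_one]
  field_simp

end Bilinear

/-- The weight `min(1, 2^j) 2^{-jα}`, summable over `j ∈ ℤ` for `0 < α < 1`. -/
def dyadicWeight (α : ℝ) (j : ℤ) : ℝ :=
  min 1 ((2 : ℝ) ^ j) * ((2 : ℝ) ^ j) ^ (-α)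

section DyadicSeries

variable {d : ℕ} {ψ : Vd d → ℝ} {α B : ℝ} {h : ℤ → Vd d → ℂ}

lemma dyadicWeight_nonneg (α : ℝ) (j : ℤ) : 0 ≤ dyadicWeight α j := by
  unfold dyadicWeight
  positivity

lemma dyadicWeight_of_nonneg {j : ℤ} (hj : 0 ≤ j) :
    dyadicWeight α j = ((2 : ℝ) ^ j) ^ (-α) := by
  rw [dyadicWeight, min_eq_left (one_le_zpow₀ one_le_two hj), one_mul]

lemma summable_dyadicWeight (hα0 : 0 < α) (hα1 : α < 1) : Summable (dyadicWeight α) := by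
  refine Summable.of_nat_of_neg ?_ ?_
  · have h1 : (2 : ℝ) ^ (-α) < 1 := Real.rpow_lt_one_of_one_lt_of_neg one_lt_two (by linarith)
    refine (summable_geometric_of_lt_one (by positivity) h1).congr fun n => ?_
    rw [dyadicWeight_of_nonneg (by positivity), zpow_natCast, ← Real.rpow_natCast,
      ← Real.rpow_natCast, ← Real.rpow_mul two_pos.le, ← Real.rpow_mul two_pos.le, mul_comm]
  · have h1 : (2 : ℝ) ^ (α - 1) < 1 := Real.rpow_lt_one_of_one_lt_of_neg one_lt_two (by linarith)
    refine (summable_geometric_of_lt_one (by positivity) h1).congr fun n => ?_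
    have h2 : (2 : ℝ) ^ (-(n : ℤ)) = 2 ^ (-(n : ℝ)) := by
      rw [← Real.rpow_intCast]
      push_cast
      rfl
    rw [dyadicWeight, min_eq_right (zpow_le_one_of_nonpos₀ one_le_two (by omega)), h2,
      ← Real.rpow_mul two_pos.le, ← Real.rpow_add two_pos, ← Real.rpow_natCast,
      ← Real.rpow_mul two_pos.le]
    congr 1
    ring

lemma two_zpow_rpow_neg (α : ℝ) (l : ℤ) :
    ((2 : ℝ) ^ l) ^ (-α) = 2 ^ (-(l : ℝ) * α) := by
  rw [← Real.rpow_intCast, ← Real.rpow_mul two_pos.le]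
  congr 1
  ring

lemma norm_le_dyadicWeight (h0 : ∀ j < 0, h j = 0) (hB0 : 0 ≤ B)
    (hB : ∀ j x, ‖h j x‖ ≤ B * ((2 : ℝ) ^ j) ^ (-α)) (j : ℤ) (x : Vd d) :
    ‖h j x‖ ≤ B * dyadicWeight α j := by
  rcases lt_or_ge j 0 with hj | hj
  · rw [h0 j hj, Pi.zero_apply, norm_zero]
    exact mul_nonneg hB0 (dyadicWeight_nonneg α j)
  · rw [dyadicWeight_of_nonneg hj]
    exact hB j x

lemma norm_tsum_dyadic_le (hα0 : 0 < α) (hα1 : α < 1) (h0 : ∀ j < 0, h j = 0) (hB0 : 0 ≤ B)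
    (hB : ∀ j x, ‖h j x‖ ≤ B * ((2 : ℝ) ^ j) ^ (-α)) (x : Vd d) :
    ‖∑' j, h j x‖ ≤ B * ∑' j, dyadicWeight α j := by
  rw [← tsum_mul_left]
  exact tsum_of_norm_bounded ((summable_dyadicWeight hα0 hα1).mul_left B).hasSum
    fun j => norm_le_dyadicWeight h0 hB0 hB j x

/-- A series of dyadically localized functions of size `2^{-jα}` is `α`-Hölder. -/
lemma exists_norm_tsum_dyadic_sub_le (hψ : LPfun ψ) (hα0 : 0 < α) (hα1 : α < 1) :
    ∃ C, 0 ≤ C ∧ ∀ (h : ℤ → Vd d → ℂ) (B : ℝ),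
      (∀ j, h j ∈ trigSpan (freqAnnulus d ((2 : ℝ) ^ j))) → (∀ j < 0, h j = 0) → 0 ≤ B →
      (∀ j x, ‖h j x‖ ≤ B * ((2 : ℝ) ^ j) ^ (-α)) →
        ∀ x y, ‖∑' j, h j x - ∑' j, h j y‖ ≤ C * B * ‖x - y‖ ^ α := by
  obtain ⟨A, hA0, hA⟩ := exists_norm_sub_le_of_mem_trigSpan hψ
  have hsum := summable_dyadicWeight hα0 hα1
  have hD : 0 ≤ ∑' j, dyadicWeight α j := tsum_nonneg (dyadicWeight_nonneg α)
  refine ⟨(2 + 2 * A) * ∑' j, dyadicWeight α j, by positivity,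
    fun h B hmem h0 hB0 hB x y => ?_⟩
  rcases eq_or_ne x y with rfl | hxy
  · rw [sub_self, norm_zero]
    positivity
  have hr : 0 < ‖x - y‖ := norm_pos_iff.mpr (sub_ne_zero.mpr hxy)
  set r := ‖x - y‖ with hrdef
  obtain ⟨N, hN⟩ := exists_mem_Ico_zpow hr one_lt_two
  have hterm : ∀ j, ‖h j x - h j y‖
      ≤ (2 + 2 * A) * B * r ^ α * dyadicWeight α (j + N) := fun j => by
    have hb1 : ‖h j x - h j y‖ ≤ 2 * (B * ((2 : ℝ) ^ j) ^ (-α)) := by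
      linarith [norm_sub_le (h j x) (h j y), hB j x, hB j y]
    have hb2 := hA _ (by positivity) (h j) (hmem j) _ (hB j) x y
    rw [← hrdef] at hb2
    have hw : ((2 : ℝ) ^ j) ^ (-α) ≤ r ^ α * ((2 : ℝ) ^ (j + N)) ^ (-α) := by
      have : ((2 : ℝ) ^ (j + N)) ^ (-α) = ((2 : ℝ) ^ j) ^ (-α) * (((2 : ℝ) ^ N) ^ α)⁻¹ := by
        rw [zpow_add₀ two_ne_zero, Real.mul_rpow (by positivity) (by positivity),
          Real.rpow_neg (by positivity : (0 : ℝ) ≤ 2 ^ N)]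
      rw [this, mul_left_comm, ← div_eq_mul_inv]
      refine le_mul_of_one_le_right (by positivity) ?_
      rw [one_le_div (by positivity)]
      exact Real.rpow_le_rpow (by positivity) hN.1 hα0.le
    have hjr : (2 : ℝ) ^ j * r ≤ 2 * (2 : ℝ) ^ (j + N) := by
      rw [zpow_add₀ two_ne_zero]
      have := hN.2.le
      rw [zpow_add_one₀ two_ne_zero] at this
      nlinarith [show (0 : ℝ) < 2 ^ j by positivity]
    set w := ((2 : ℝ) ^ j) ^ (-α)
    have hw0 : 0 ≤ w := by positivity
    set m := min 1 ((2 : ℝ) ^ (j + N)) with hm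
    have hm0 : 0 ≤ m := by positivity
    have hb : ‖h j x - h j y‖ ≤ (2 + 2 * A) * m * (B * w) := by
      rcases min_cases 1 ((2 : ℝ) ^ (j + N)) with ⟨hc, -⟩ | ⟨hc, -⟩
      · rw [hm, hc, mul_one]
        refine hb1.trans ?_
        gcongr
        linarith
      · rw [hm, hc]
        have h3 : A * (2 : ℝ) ^ j * (B * w) * r = A * ((2 : ℝ) ^ j * r) * (B * w) := by ring
        rw [h3] at hb2
        refine hb2.trans ?_
        have h4 : A * ((2 : ℝ) ^ j * r) ≤ A * (2 * (2 : ℝ) ^ (j + N)) := by gcongr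
        have h5 : (0 : ℝ) < 2 ^ (j + N) := by positivity
        refine mul_le_mul_of_nonneg_right ?_ (by positivity)
        linarith
    refine hb.trans ?_
    calc (2 + 2 * A) * m * (B * w)
        ≤ (2 + 2 * A) * m * (B * (r ^ α * ((2 : ℝ) ^ (j + N)) ^ (-α))) := by gcongr
      _ = (2 + 2 * A) * B * r ^ α * dyadicWeight α (j + N) := by
        rw [dyadicWeight, ← hm]
        ring
  have hs : ∀ z, Summable fun j => h j z := fun z =>
    Summable.of_norm_bounded (hsum.mul_left B) fun j => norm_le_dyadicWeight h0 hB0 hB j z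
  rw [← (hs x).tsum_sub (hs y)]
  have hshift : HasSum (fun j => dyadicWeight α (j + N)) (∑' j, dyadicWeight α j) :=
    (Equiv.addRight N).hasSum_iff.mpr hsum.hasSum
  refine (tsum_of_norm_bounded (hshift.mul_left _) hterm).trans_eq ?_
  ring

lemma fCoeff_tsum_dyadic (hα0 : 0 < α) (hα1 : α < 1)
    (hmem : ∀ j, h j ∈ trigSpan (freqAnnulus d ((2 : ℝ) ^ j))) (h0 : ∀ j < 0, h j = 0)
    (hB0 : 0 ≤ B) (hB : ∀ j x, ‖h j x‖ ≤ B * ((2 : ℝ) ^ j) ^ (-α)) (k : Fin d → ℤ) :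
    fCoeff (fun x => ∑' j, h j x) k = ∑' j, fCoeff (h j) k := by
  have hcont := fun j => continuous_of_mem_trigSpan (hmem j)
  have hint := fun j => integrableOn_mul_tchar (hcont j) (-k)
  have hsum : Summable fun j => ∫ x in box d, ‖h j x * tchar (-k) x‖ := by
    refine Summable.of_nonneg_of_le (fun j => by positivity) (fun j => ?_)
      (((summable_dyadicWeight hα0 hα1).mul_left B).mul_right (volume.real (box d)))
    refine (Real.le_norm_self _).trans
      (norm_setIntegral_le_of_norm_le_const isCompact_Icc.measure_lt_top fun x _ => ?_)
    rw [norm_norm, norm_mul, norm_tchar, mul_one]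
    exact norm_le_dyadicWeight h0 hB0 hB j x
  have key := hasSum_integral_of_summable_integral_norm hint hsum
  simp only [fCoeff_eq, ← tsum_mul_right]
  exact (key.const_smul (((2 * Real.pi) ^ d)⁻¹ : ℝ)).tsum_eq.symm

/-- Littlewood–Paley blocks of a series of dyadically localized functions of size `2^{-jα}`. -/
lemma exists_norm_LPblock_tsum_dyadic_le (hψ : LPfun ψ) (hα0 : 0 < α) (hα1 : α < 1) :
    ∃ C, 0 ≤ C ∧ ∀ (h : ℤ → Vd d → ℂ) (B : ℝ),
      (∀ j, h j ∈ trigSpan (freqAnnulus d ((2 : ℝ) ^ j))) → (∀ j < 0, h j = 0) → 0 ≤ B →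
      (∀ j x, ‖h j x‖ ≤ B * ((2 : ℝ) ^ j) ^ (-α)) →
        ∀ l x, ‖LPblock ψ l (fun x => ∑' j, h j x) x‖ ≤ C * B * ((2 : ℝ) ^ l) ^ (-α) := by
  obtain ⟨A, hA0, hA⟩ := exists_norm_LPblock_le hψ
  refine ⟨A * 20, by positivity, fun h B hmem h0 hB0 hB l x => ?_⟩
  have hcoeff := fCoeff_tsum_dyadic hα0 hα1 hmem h0 hB0 hB
  rcases lt_or_ge l 0 with hl | hl
  · have hz : LPblock ψ l (fun x => ∑' j, h j x) x = 0 := by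
      rw [LPblock]
      split_ifs with h1 h2
      · rfl
      · rw [hcoeff]
        refine (tsum_congr fun j => fCoeff_eq_zero_of_mem_trigSpan (hmem j) fun hk => ?_).trans
          tsum_zero
        have := hk.1
        rw [kAbs_zero] at this
        have hpos : (0 : ℝ) < 2 ^ j := by positivity
        linarith
      · omega
    rw [hz, norm_zero]
    positivity
  set P : Vd d → ℂ := ∑ j ∈ Finset.Icc (l - 2) (l + 2), h j with hP
  have hPmem : P ∈ trigSpan Set.univ :=
    Submodule.sum_mem _ fun j _ => trigSpan_mono (Set.subset_univ _) (hmem j)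
  have heq : LPblock ψ l (fun x => ∑' j, h j x) = LPblock ψ l P := by
    rw [LPblock_eq_fmul hl, LPblock_eq_fmul hl]
    funext z
    refine tsum_congr fun k => ?_
    by_cases hk : dilSymbol (annCutoff ψ 1 2) ((2 : ℝ) ^ l) k = 0
    · simp only [hk, zero_mul]
    obtain ⟨hk1, hk2⟩ := bounds_of_dilSymbol_annCutoff_ne_zero hψ hk
    rw [hcoeff, hP, fCoeff_sum _ fun j => continuous_of_mem_trigSpan (hmem j),
      tsum_eq_sum (s := Finset.Icc (l - 2) (l + 2)) fun j hj => ?_]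
    refine fCoeff_eq_zero_of_mem_trigSpan (hmem j) fun hkj => hj ?_
    have hpos : (0 : ℝ) < 2 ^ l := by positivity
    rw [Finset.mem_Icc]
    constructor
    · by_contra! hlt
      have h3 : (2 : ℝ) ^ j ≤ 2 ^ (l - 3) := zpow_le_zpow_right₀ one_le_two (by omega)
      have h4 : (2 : ℝ) ^ (l - 3) = 2 ^ l / 8 := by
        rw [zpow_sub₀ two_ne_zero]
        norm_num
      linarith [hkj.2]
    · by_contra! hlt
      have h3 : (2 : ℝ) ^ (l + 3) ≤ 2 ^ j := zpow_le_zpow_right₀ one_le_two (by omega)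
      have h4 : (2 : ℝ) ^ (l + 3) = 2 ^ l * 8 := by
        rw [zpow_add₀ two_ne_zero]
        norm_num
      linarith [hkj.1]
  have hPle : ∀ z, ‖P z‖ ≤ 20 * (B * ((2 : ℝ) ^ l) ^ (-α)) := fun z => by
    rw [hP, Finset.sum_apply]
    have hterm : ∀ j ∈ Finset.Icc (l - 2) (l + 2),
        ‖h j z‖ ≤ 4 * (B * ((2 : ℝ) ^ l) ^ (-α)) := fun j hj => by
      rw [Finset.mem_Icc] at hj
      have h1 : ((2 : ℝ) ^ j) ^ (-α) ≤ ((2 : ℝ) ^ (l - 2)) ^ (-α) :=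
        Real.rpow_le_rpow_of_nonpos (by positivity)
          (zpow_le_zpow_right₀ one_le_two hj.1) (by linarith)
      have h2 : ((2 : ℝ) ^ (l - 2)) ^ (-α) = ((2 : ℝ) ^ l) ^ (-α) * 4 ^ α := by
        rw [zpow_sub₀ two_ne_zero, Real.div_rpow (by positivity) (by positivity),
          Real.rpow_neg (by positivity : (0 : ℝ) ≤ 2 ^ (2 : ℤ)), div_inv_eq_mul]
        norm_num
      have h3 : (4 : ℝ) ^ α ≤ 4 := by
        simpa using Real.rpow_le_rpow_of_exponent_le (by norm_num : (1 : ℝ) ≤ 4) hα1.le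
      calc ‖h j z‖ ≤ B * ((2 : ℝ) ^ j) ^ (-α) := hB j z
        _ ≤ B * (((2 : ℝ) ^ l) ^ (-α) * 4) := by
          gcongr
          exact h1.trans (h2.trans_le (by gcongr))
        _ = 4 * (B * ((2 : ℝ) ^ l) ^ (-α)) := by ring
    refine (norm_sum_le_of_le _ hterm).trans_eq ?_
    rw [Finset.sum_const, Int.card_Icc, show (l + 2 + 1 - (l - 2)).toNat = 5 by omega,
      nsmul_eq_mul]
    push_cast
    ring
  rw [heq]
  refine (hA P (continuous_of_mem_trigSpan hPmem) (torusFun_of_mem_trigSpan hPmem) _ hPle l hl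
    x).trans_eq ?_
  ring

end DyadicSeries

lemma hSemi_nonneg {d : ℕ} {F : Type*} [NormedAddCommGroup F] (α : ℝ)
    (f : Vd d → F) : 0 ≤ hSemi α f :=
  Real.iSup_nonneg fun p => by split_ifs <;> positivity

section HolderNorms

variable {d : ℕ} {F : Type*} [NormedAddCommGroup F] [NormedSpace ℝ F] {α : ℝ} {f : Vd d → F}

lemma CkNorm_zero (f : Vd d → F) : CkNorm 0 f = ⨆ x, ‖f x‖ := by
  simp [CkNorm]

lemma hSemi_iteratedFDeriv_zero (α : ℝ) (f : Vd d → F) :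
    hSemi α (iteratedFDeriv ℝ 0 f) = hSemi α f := by
  simp only [hSemi, iteratedFDeriv_zero_eq_comp, Function.comp_apply, ← map_sub,
    LinearIsometryEquiv.norm_map]

lemma CkNorm_zero_le {M : ℝ} (h : ∀ x, ‖f x‖ ≤ M) : CkNorm 0 f ≤ M := by
  rw [CkNorm_zero]
  exact ciSup_le h

lemma CkNorm_zero_nonneg (f : Vd d → F) : 0 ≤ CkNorm 0 f := by
  rw [CkNorm_zero]
  exact Real.iSup_nonneg fun x => norm_nonneg _

lemma hSemi_le_HolNorm_zero (α : ℝ) (f : Vd d → F) : hSemi α f ≤ HolNorm 0 α f := by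
  rw [HolNorm, hSemi_iteratedFDeriv_zero]
  exact le_add_of_nonneg_left (CkNorm_zero_nonneg f)

lemma HolNorm_zero_nonneg (α : ℝ) (f : Vd d → F) : 0 ≤ HolNorm 0 α f :=
  (hSemi_nonneg α f).trans (hSemi_le_HolNorm_zero α f)

lemma HolNorm_zero_le {M H : ℝ} (hM : ∀ x, ‖f x‖ ≤ M) (hH0 : 0 ≤ H)
    (hH : ∀ x y, ‖f x - f y‖ ≤ H * ‖x - y‖ ^ α) : HolNorm 0 α f ≤ M + H := by
  rw [HolNorm, hSemi_iteratedFDeriv_zero]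
  refine add_le_add (CkNorm_zero_le hM) (Real.iSup_le (fun p => ?_) hH0)
  split_ifs with hp
  · exact hH0
  · have : 0 < ‖p.1 - p.2‖ := norm_pos_iff.mpr (sub_ne_zero.mpr hp)
    rw [div_le_iff₀ (by positivity)]
    exact hH _ _

lemma norm_le_CkNorm_zero (hf : Continuous f) (hp : TorusFun f) (x : Vd d) :
    ‖f x‖ ≤ CkNorm 0 f := by
  obtain ⟨M, hM⟩ := exists_norm_le_of_torusFun hf hp
  rw [CkNorm_zero]
  exact le_ciSup ⟨M, Set.forall_mem_range.mpr hM⟩ x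

lemma torusFun_fderiv (hp : TorusFun f) : TorusFun (fderiv ℝ f) := fun x m => by
  rw [← fderiv_comp_add_right, funext fun y => hp y m]

lemma exists_norm_sub_le_rpow (hα0 : 0 < α) (hα1 : α < 1) (hf : ContDiff ℝ 1 f)
    (hp : TorusFun f) : ∃ H, ∀ x y, ‖f x - f y‖ ≤ H * ‖x - y‖ ^ α := by
  obtain ⟨M, hM⟩ := exists_norm_le_of_torusFun hf.continuous hp
  obtain ⟨L, hL⟩ := exists_norm_le_of_torusFun (hf.continuous_fderiv one_ne_zero)
    (torusFun_fderiv hp)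
  have hM0 := (norm_nonneg _).trans (hM 0)
  have hL0 := (norm_nonneg _).trans (hL 0)
  refine ⟨L + 2 * M, fun x y => ?_⟩
  have hlip : ‖f x - f y‖ ≤ L * ‖x - y‖ :=
    convex_univ.norm_image_sub_le_of_norm_fderiv_le
      (fun z _ => hf.differentiable one_ne_zero z) (fun z _ => hL z) (Set.mem_univ y)
      (Set.mem_univ x)
  rcases le_or_gt ‖x - y‖ 1 with hr | hr
  · have h1 : ‖x - y‖ ≤ ‖x - y‖ ^ α := by
      simpa using Real.rpow_le_rpow_of_exponent_ge' (norm_nonneg _) hr hα0.le hα1.le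
    calc ‖f x - f y‖ ≤ L * ‖x - y‖ := hlip
      _ ≤ (L + 2 * M) * ‖x - y‖ ^ α := by
        gcongr
        linarith
  · have h1 : 1 ≤ ‖x - y‖ ^ α := Real.one_le_rpow hr.le hα0.le
    have h2 : ‖f x - f y‖ ≤ L + 2 * M := by
      linarith [norm_sub_le (f x) (f y), hM x, hM y]
    exact h2.trans (le_mul_of_one_le_right (by positivity) h1)

lemma norm_sub_le_HolNorm_zero (hα0 : 0 < α) (hα1 : α < 1) (hf : ContDiff ℝ 1 f)
    (hp : TorusFun f) (x y : Vd d) : ‖f x - f y‖ ≤ HolNorm 0 α f * ‖x - y‖ ^ α := by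
  rcases eq_or_ne x y with rfl | hxy
  · rw [sub_self, norm_zero]
    exact mul_nonneg (HolNorm_zero_nonneg α f) (by positivity)
  obtain ⟨H, hH⟩ := exists_norm_sub_le_rpow hα0 hα1 hf hp
  have hr : 0 < ‖x - y‖ := norm_pos_iff.mpr (sub_ne_zero.mpr hxy)
  rw [← div_le_iff₀ (by positivity)]
  refine le_trans ?_ (hSemi_le_HolNorm_zero α f)
  have hbdd : BddAbove (Set.range fun p : Vd d × Vd d =>
      if p.1 = p.2 then 0 else ‖f p.1 - f p.2‖ / ‖p.1 - p.2‖ ^ α) := by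
    refine ⟨|H|, Set.forall_mem_range.mpr fun p => ?_⟩
    split_ifs with hp'
    · positivity
    · have : 0 < ‖p.1 - p.2‖ := norm_pos_iff.mpr (sub_ne_zero.mpr hp')
      rw [div_le_iff₀ (by positivity)]
      exact (hH _ _).trans (by gcongr; exact le_abs_self H)
  have := le_ciSup hbdd (x, y)
  rwa [if_neg hxy] at this

end HolderNorms

/-- The block and Hölder bounds for a series of paraproduct terms. -/
lemma exists_paraproduct_series_le {ψ : Vd 2 → ℝ} (hψ : LPfun ψ) {α : ℝ} (hα0 : 0 < α)
    (hα1 : α < 1) {j₀ : ℤ} (hj₀ : 4 ≤ j₀) :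
    ∃ C, 0 < C ∧ ∀ f g : Vd 2 → ℝ, ContDiff ℝ (⊤ : ℕ∞) f → ContDiff ℝ (⊤ : ℕ∞) g →
      TorusFun f → TorusFun g → ∀ h : ℤ → Vd 2 → ℂ,
      (h = (fun j => Tbil (LPblock ψ j (cplx f)) (LPlow ψ (j - j₀) (cplx g))) ∨
        h = fun j => Tbil (LPlow ψ (j - j₀) (cplx g)) (LPblock ψ j (cplx f))) →
      (∀ l : ℤ, CkNorm 0 (LPblock ψ l (fun x => ∑' j, h j x))
          ≤ C * (2 : ℝ) ^ (-(l : ℝ) * α) * (HolNorm 0 α f * CkNorm 0 g)) ∧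
      HolNorm 0 α (fun x => ∑' j, h j x) ≤ C * (HolNorm 0 α f * CkNorm 0 g) := by
  obtain ⟨A, hA0, hA⟩ := exists_norm_Tbil_LPblock_LPlow_le hψ hα0 hα1
  obtain ⟨K, hK0, hK⟩ := exists_norm_tsum_dyadic_sub_le hψ hα0 hα1
  obtain ⟨L, hL0, hL⟩ := exists_norm_LPblock_tsum_dyadic_le hψ hα0 hα1
  set D := ∑' j, dyadicWeight α j
  have hD0 : 0 ≤ D := tsum_nonneg (dyadicWeight_nonneg α)
  refine ⟨(D + K + L) * A + 1, by positivity, fun f g hf hg hfp hgp h hh => ?_⟩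
  set N := HolNorm 0 α f * CkNorm 0 g
  have hN0 : 0 ≤ N := mul_nonneg (HolNorm_zero_nonneg α f) (CkNorm_zero_nonneg g)
  have hcplx : ∀ {u : Vd 2 → ℝ}, TorusFun u → TorusFun (cplx u) := fun hu x m =>
    congrArg Complex.ofReal (hu x m)
  have hcont : ∀ {u : Vd 2 → ℝ}, ContDiff ℝ (⊤ : ℕ∞) u → Continuous (cplx u) := fun hu =>
    Complex.continuous_ofReal.comp hu.continuous
  have hf1 : ContDiff ℝ 1 f := hf.of_le (by exact_mod_cast le_top)
  have hfH : ∀ x y, ‖cplx f x - cplx f y‖ ≤ HolNorm 0 α f * ‖x - y‖ ^ α := fun x y => by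
    have := norm_sub_le_HolNorm_zero hα0 hα1 hf1 hfp x y
    rwa [cplx, cplx, ← Complex.ofReal_sub, Complex.norm_real]
  have hgM : ∀ x, ‖cplx g x‖ ≤ CkNorm 0 g := fun x => by
    rw [cplx, Complex.norm_real]
    exact norm_le_CkNorm_zero hg.continuous hgp x
  have hmem : ∀ j, h j ∈ trigSpan (freqAnnulus 2 ((2 : ℝ) ^ j)) := fun j => by
    have := Tbil_LPblock_LPlow_mem_trigSpan hψ (show j - j₀ ≤ j - 4 by omega) (cplx f) (cplx g)
    rcases hh with rfl | rfl
    · exact this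
    · simp only [Tbil_swap (LPlow ψ (j - j₀) (cplx g))]
      exact Submodule.neg_mem _ this
  have hB : ∀ j x, ‖h j x‖ ≤ A * N * ((2 : ℝ) ^ j) ^ (-α) := fun j x => by
    have := hA (cplx f) (cplx g) (hcont hf) (hcplx hfp) (hcont hg) (hcplx hgp) _
      (HolNorm_zero_nonneg α f) hfH _ hgM (j - j₀) j (by omega) x
    rcases hh with rfl | rfl
    · exact this
    · simp only [Tbil_swap (LPlow ψ (j - j₀) (cplx g)), Pi.neg_apply, norm_neg]
      exact this
  have h0 : ∀ j < 0, h j = 0 := fun j hj => by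
    have := Tbil_zero_right (LPblock ψ j (cplx f))
    rw [← LPlow_eq_zero (ψ := ψ) (show j - j₀ < -1 by omega) (cplx g)] at this
    rcases hh with rfl | rfl
    · exact this.trans (LPlow_eq_zero (by omega) _)
    · simp only [Tbil_swap (LPlow ψ (j - j₀) (cplx g)), this]
      rw [LPlow_eq_zero (by omega), neg_zero]
  have hAN : 0 ≤ A * N := by positivity
  constructor
  · intro l
    refine CkNorm_zero_le fun x => (hL h _ hmem h0 hAN hB l x).trans ?_
    rw [two_zpow_rpow_neg]
    have h1 : L * A ≤ (D + K + L) * A + 1 := by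
      have : 0 ≤ (D + K) * A := by positivity
      linarith
    calc L * (A * N) * (2 : ℝ) ^ (-(l : ℝ) * α) = L * A * (2 : ℝ) ^ (-(l : ℝ) * α) * N := by ring
      _ ≤ _ := by gcongr
  · refine (HolNorm_zero_le (norm_tsum_dyadic_le hα0 hα1 h0 hAN hB) (by positivity)
      (hK h _ hmem h0 hAN hB)).trans ?_
    have h1 : 0 ≤ (L * A + 1) * N := by positivity
    linarith

/-- For `j₀ ≥ 4`, the high–low part of `T[f,g] = Λ^{-1}((Λf)g - f(Λg))`
satisfies `‖Δ_l T_{HL}[f,g]‖₀ ≲ 2^{-lα}‖f‖_α‖g‖₀` for every `l ∈ ℤ`, hence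
`‖T_{HL}[f,g]‖_α ≲ ‖f‖_α‖g‖₀`; the same bounds hold for `T_{LH}` with the roles of
`f` and `g` exchanged. Constants depend only on `α` and `j₀` (and `ψ`). -/
theorem paraproduct_HL_LH_estimate (α : ℝ) (hα0 : 0 < α) (hα1 : α < 1)
    (j₀ : ℤ) (hj₀ : 4 ≤ j₀) (ψ : Vd 2 → ℝ) (hψ : LPfun ψ) :
    ∃ C > 0, ∀ f g : Vd 2 → ℝ,
      ContDiff ℝ (⊤ : ℕ∞) f → ContDiff ℝ (⊤ : ℕ∞) g → TorusFun f → TorusFun g →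
      (∀ l : ℤ, CkNorm 0 (LPblock ψ l (THL ψ j₀ (cplx f) (cplx g)))
          ≤ C * (2:ℝ) ^ (-(l : ℝ) * α) * HolNorm 0 α f * CkNorm 0 g) ∧
      HolNorm 0 α (THL ψ j₀ (cplx f) (cplx g)) ≤ C * HolNorm 0 α f * CkNorm 0 g ∧
      (∀ l : ℤ, CkNorm 0 (LPblock ψ l (TLH ψ j₀ (cplx f) (cplx g)))
          ≤ C * (2:ℝ) ^ (-(l : ℝ) * α) * CkNorm 0 f * HolNorm 0 α g) ∧
      HolNorm 0 α (TLH ψ j₀ (cplx f) (cplx g)) ≤ C * CkNorm 0 f * HolNorm 0 α g := by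
  obtain ⟨C, hC0, hC⟩ := exists_paraproduct_series_le hψ hα0 hα1 hj₀
  refine ⟨C, hC0, fun f g hf hg hfp hgp => ?_⟩
  obtain ⟨h1, h2⟩ := hC f g hf hg hfp hgp _ (Or.inl rfl)
  obtain ⟨h3, h4⟩ := hC g f hg hf hgp hfp _ (Or.inr rfl)
  refine ⟨fun l => (h1 l).trans_eq (by ring), h2.trans_eq (by ring),
    fun l => (h3 l).trans_eq (by ring), h4.trans_eq (by ring)⟩
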